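/- arXiv:1304.5615 — 2 statements merged into one kernel-verified Lean document; each statement's English description precedes it below -/
import Mathlib

section
/- Fix an increasing sequence (k_n)_{n≥1} of positive integers with k_n ≤ n for all n and k_n → ∞, and set rat_n = B_{n−1,k_n}/B_{n,k_n}. Let X^T_n be the number of equivalence classes of simple-x trees of type T of size n using at most k_n distinct variables and T_n the number of equivalence classes of all and/or trees of size n using at most k_n distinct variables. Then, asymptotically as n → ∞, X^T_n/T_n ∼ (3/8)·rat_n. -/
open Filter

namespace CatalanSat

/-- A logical connective: `and` or `or`. -/
inductive Conn : Type
  | and : Conn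
  | or : Conn

/-- An and/or tree: a binary plane tree with internal nodes labelled by a
connective and leaves labelled by a literal `(v, b)`: variable `v`, positive
if `b = true`, negated if `b = false`. -/
inductive AOTree : Type
  | leaf (v : ℕ) (b : Bool) : AOTree
  | node (c : Conn) (l r : AOTree) : AOTree

namespace AOTree

/-- The list of leaf labels (variable index, polarity), from left to right. -/
def leaves : AOTree → List (ℕ × Bool)
  | .leaf v b => [(v, b)]
  | .node _ l r => leaves l ++ leaves r

/-- The size of an and/or tree is its number of leaves. -/
def size (t : AOTree) : ℕ := t.leaves.length

/-- The number of distinct variables appearing as leaf labels. -/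
def varCount (t : AOTree) : ℕ := (t.leaves.map Prod.fst).toFinset.card

/-- The Boolean function computed by an and/or tree. -/
def eval : AOTree → (ℕ → Bool) → Bool
  | .leaf v b, x => if b then x v else !(x v)
  | .node .and l r, x => eval l x && eval r x
  | .node .or l r, x => eval l x || eval r x

end AOTree

/-- A tree-structure: a binary plane tree with internal nodes labelled by a
connective and unlabelled leaves. -/
inductive Shape : Type
  | leaf : Shape
  | node (c : Conn) (l r : Shape) : Shape

/-- The size of a tree-structure is its number of leaves. -/
def Shape.size : Shape → ℕ
  | .leaf => 1
  | .node _ l r => Shape.size l + Shape.size r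

/-- The tree-structure of an and/or tree (forget the leaf labels). -/
def AOTree.shape : AOTree → Shape
  | .leaf _ _ => .leaf
  | .node c l r => .node c l.shape r.shape

/-- The label of the `i`-th leaf (junk default when out of range). -/
def lv (t : AOTree) (i : ℕ) : ℕ × Bool := t.leaves.getD i (0, true)

/-- Two and/or trees are equivalent when they have the same tree-structure,
two leaves are labelled by the same variable in one iff they are in the other,
and two leaves are labelled by the same literal in one iff they are in the other. -/
def TreeEquiv (A B : AOTree) : Prop :=
  A.shape = B.shape ∧
  ∀ i j : ℕ, i < A.leaves.length → j < A.leaves.length →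
    (((lv A i).1 = (lv A j).1) ↔ ((lv B i).1 = (lv B j).1)) ∧
    ((lv A i = lv A j) ↔ (lv B i = lv B j))

/-- The equivalence relation on Boolean functions induced by equivalence of trees. -/
def FunEquiv (f g : (ℕ → Bool) → Bool) : Prop :=
  ∃ A B : AOTree, TreeEquiv A B ∧ A.eval = f ∧ B.eval = g

/-- The number of equivalence classes of and/or trees satisfying a property
(the property being assumed invariant under equivalence). -/
noncomputable def classCount (P : AOTree → Prop) : ℕ :=
  Nat.card (Quot (fun A B : {t : AOTree // P t} => TreeEquiv A.1 B.1))

/-- `Tcount n K`: number of equivalence classes of and/or trees of size `n`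
using at most `K` distinct variables. -/
noncomputable def Tcount (n K : ℕ) : ℕ := classCount fun t => t.size = n ∧ t.varCount ≤ K

/-- Number of such classes computing a function of the class `⟨f⟩`. -/
noncomputable def TcountClass (n K : ℕ) (f : (ℕ → Bool) → Bool) : ℕ :=
  classCount fun t => t.size = n ∧ t.varCount ≤ K ∧ FunEquiv t.eval f

/-- `P_n⟨f⟩`: the probability that a uniform equivalence class of trees of size
`n` (at most `K` variables) computes a function of `⟨f⟩`. -/
noncomputable def Pclass (n K : ℕ) (f : (ℕ → Bool) → Bool) : ℝ :=
  (TcountClass n K f : ℝ) / (Tcount n K : ℝ)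

/-- Number of classes of size `n`, at most `K` variables, computing exactly `f`. -/
noncomputable def TcountEval (n K : ℕ) (f : (ℕ → Bool) → Bool) : ℕ :=
  classCount fun t => t.size = n ∧ t.varCount ≤ K ∧ t.eval = f

/-- Stirling numbers of the second kind. -/
def stirling : ℕ → ℕ → ℕ
  | 0, 0 => 1
  | 0, _ + 1 => 0
  | _ + 1, 0 => 0
  | n + 1, k + 1 => (k + 1) * stirling n (k + 1) + stirling n k

/-- `B n k = Σ_{p=1}^{k} S(n,p)·2^{−p}`. -/
noncomputable def B (n k : ℕ) : ℝ :=
  ∑ p ∈ Finset.Icc 1 k, (stirling n p : ℝ) / 2 ^ p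

/-- `a n p = p^n/(p!·2^p)`. -/
noncomputable def a (n p : ℕ) : ℝ :=
  (p : ℝ) ^ n / ((Nat.factorial p : ℝ) * 2 ^ p)

/-- `rat_n = B_{n−1,k_n}/B_{n,k_n}`. -/
noncomputable def rat (k : ℕ → ℕ) (n : ℕ) : ℝ := B (n - 1) (k n) / B n (k n)

/-- The complexity `L(f)`: minimal size of an and/or tree computing `f`. -/
noncomputable def complexity (f : (ℕ → Bool) → Bool) : ℕ :=
  sInf {m | ∃ t : AOTree, t.size = m ∧ t.eval = f}

/-- The variable `x_i` is essential for `f`. -/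
def Essential (i : ℕ) (f : (ℕ → Bool) → Bool) : Prop :=
  ∃ x : ℕ → Bool, f (Function.update x i false) ≠ f (Function.update x i true)

/-- `E(f)`: the number of essential variables of `f`. -/
noncomputable def essCount (f : (ℕ → Bool) → Bool) : ℕ :=
  Nat.card {i : ℕ // Essential i f}

/-- The multiplicity `R⟨f⟩ = L⟨f⟩ − E⟨f⟩`. -/
noncomputable def mult (f : (ℕ → Bool) → Bool) : ℕ := complexity f - essCount f

/-- `M` is, for each `n ≥ 1`, an index of `{1,…,n}` maximizing `p ↦ p^n/(p!·2^p)`. -/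
def IsArgmax (M : ℕ → ℕ) : Prop :=
  ∀ n, 1 ≤ n → M n ∈ Finset.Icc 1 n ∧ ∀ p ∈ Finset.Icc 1 n, a n p ≤ a n (M n)

/-- There is a leaf labelled by the given literal linked to the root by
`∨`-labelled internal nodes only. -/
def orLeaf : AOTree → ℕ × Bool → Prop
  | .leaf v b, l => (v, b) = l
  | .node .or A B, l => orLeaf A l ∨ orLeaf B l
  | .node .and _ _, _ => False

/-- There is a leaf labelled by the given literal linked to the root by
`∧`-labelled internal nodes only. -/
def andLeaf : AOTree → ℕ × Bool → Prop
  | .leaf v b, l => (v, b) = l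
  | .node .and A B, l => andLeaf A l ∨ andLeaf B l
  | .node .or _ _, _ => False

/-- A simple tautology: two leaves labelled by a variable and its negation,
both linked to the root through `∨`-connectives only. -/
def IsSimpleTautology (t : AOTree) : Prop :=
  ∃ v b, orLeaf t (v, b) ∧ orLeaf t (v, !b)

/-- A simple contradiction: the dual notion. -/
def IsSimpleContradiction (t : AOTree) : Prop :=
  ∃ v b, andLeaf t (v, b) ∧ andLeaf t (v, !b)

/-- A tautology: a tree computing the constant function `true`. -/
def IsTautology (t : AOTree) : Prop := ∀ x : ℕ → Bool, t.eval x = true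

/-- A simple-x of type T: one subtree of the root is a single leaf, the other
is a simple tautology if the root is `∧`, a simple contradiction if it is `∨`. -/
def IsSimpleXT (t : AOTree) : Prop :=
  (∃ v b s, (t = .node .and (.leaf v b) s ∨ t = .node .and s (.leaf v b)) ∧
    IsSimpleTautology s) ∨
  (∃ v b s, (t = .node .or (.leaf v b) s ∨ t = .node .or s (.leaf v b)) ∧
    IsSimpleContradiction s)

/-- A simple-x of type X: one subtree of the root is a single leaf `ℓ`, the root
is `∧` (resp. `∨`), and the other subtree has a leaf labelled by the literal of
`ℓ` linked to its root by `∨`-only (resp. `∧`-only) internal nodes. -/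
def IsSimpleXX (t : AOTree) : Prop :=
  (∃ v b s, (t = .node .and (.leaf v b) s ∨ t = .node .and s (.leaf v b)) ∧
    orLeaf s (v, b)) ∨
  (∃ v b s, (t = .node .or (.leaf v b) s ∨ t = .node .or s (.leaf v b)) ∧
    andLeaf s (v, b))

section Labellings

open scoped Classical

/-- Two labellings by literals are related when they induce the same coincidences of
variables and the same coincidences of literals. -/
def labelSetoid (n : ℕ) : Setoid (Fin n → ℕ × Bool) where
  r g h := ∀ i j, ((g i).1 = (g j).1 ↔ (h i).1 = (h j).1) ∧ (g i = g j ↔ h i = h j)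
  iseqv :=
    { refl := fun _ _ _ => ⟨Iff.rfl, Iff.rfl⟩
      symm := fun H i j => ⟨(H i j).1.symm, (H i j).2.symm⟩
      trans := fun H H' i j => ⟨(H i j).1.trans (H' i j).1, (H i j).2.trans (H' i j).2⟩ }

/-- Classes of labellings of `n` positions by literals. -/
abbrev LabelClass (n : ℕ) : Type := Quotient (labelSetoid n)

namespace LabelClass

/-- The class of a labelling. -/
def of {n : ℕ} (g : Fin n → ℕ × Bool) : LabelClass n := Quotient.mk (labelSetoid n) g

theorem of_eq_of_iff {n : ℕ} {g h : Fin n → ℕ × Bool} :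
    of g = of h ↔
      ∀ i j, ((g i).1 = (g j).1 ↔ (h i).1 = (h j).1) ∧ (g i = g j ↔ h i = h j) :=
  Quotient.eq (r := labelSetoid n)

theorem exists_of {n : ℕ} (c : LabelClass n) : ∃ g, of g = c := Quotient.exists_rep c

instance finite (n : ℕ) : Finite (LabelClass n) := by
  let F : LabelClass n → Fin n → Fin n → Prop × Prop :=
    Quotient.lift (s := labelSetoid n)
      (fun g i j => ((g i).1 = (g j).1, g i = g j))
      (fun _ _ H => by
        funext i j
        exact Prod.ext (propext (H i j).1) (propext (H i j).2))
  refine Finite.of_injective F ?_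
  intro c d hcd
  obtain ⟨g, rfl⟩ := exists_of c
  obtain ⟨h, rfl⟩ := exists_of d
  refine of_eq_of_iff.2 fun i j => ?_
  have := congrFun (congrFun hcd i) j
  exact ⟨iff_of_eq (congrArg Prod.fst this), iff_of_eq (congrArg Prod.snd this)⟩

noncomputable instance fintype (n : ℕ) : Fintype (LabelClass n) := Fintype.ofFinite _

/-- The number of variables of a class of labellings. -/
noncomputable def vars {n : ℕ} : LabelClass n → ℕ :=
  Quotient.lift (s := labelSetoid n) (fun g => (Set.range fun i => (g i).1).ncard)
    (fun g h H =>
      Nat.card_congr ((Setoid.quotientKerEquivRange fun i => (g i).1).symm.trans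
        ((Quotient.congrRight fun i j => (H i j).1).trans
          (Setoid.quotientKerEquivRange fun i => (h i).1))))

theorem vars_of {n : ℕ} (g : Fin n → ℕ × Bool) :
    vars (of g) = (Set.range fun i => (g i).1).ncard := rfl

/-- Two positions carry opposite literals. -/
def Opp {n : ℕ} (c : LabelClass n) (i j : Fin n) : Prop :=
  Quotient.lift (s := labelSetoid n) (fun g => (g i).1 = (g j).1 ∧ g i ≠ g j)
    (fun _ _ H => propext (and_congr (H i j).1 (not_congr (H i j).2))) c

theorem opp_of {n : ℕ} {g : Fin n → ℕ × Bool} {i j : Fin n} :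
    Opp (of g) i j ↔ (g i).1 = (g j).1 ∧ g i ≠ g j := Iff.rfl

theorem Opp.symm {n : ℕ} {c : LabelClass n} {i j : Fin n} (h : Opp c i j) : Opp c j i := by
  obtain ⟨g, rfl⟩ := exists_of c
  exact ⟨h.1.symm, h.2.symm⟩

theorem Opp.ne {n : ℕ} {c : LabelClass n} {i j : Fin n} (h : Opp c i j) : i ≠ j := by
  obtain ⟨g, rfl⟩ := exists_of c
  rintro rfl
  exact h.2 rfl

/-- Forget the label of one position. -/
def del {n : ℕ} (j : Fin (n + 1)) : LabelClass (n + 1) → LabelClass n :=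
  Quotient.map (sa := labelSetoid (n + 1)) (sb := labelSetoid n)
    (fun g => g ∘ j.succAbove) (fun _ _ H _ _ => H _ _)

theorem del_of {n : ℕ} (j : Fin (n + 1)) (g : Fin (n + 1) → ℕ × Bool) :
    del j (of g) = of (g ∘ j.succAbove) := rfl

theorem opp_del {n : ℕ} (j : Fin (n + 1)) (c : LabelClass (n + 1)) (a b : Fin n) :
    Opp (del j c) a b ↔ Opp c (j.succAbove a) (j.succAbove b) := by
  obtain ⟨g, rfl⟩ := exists_of c
  rfl

theorem of_insertNth_congr {n : ℕ} (j : Fin (n + 1)) {x y : ℕ × Bool} {g h : Fin n → ℕ × Bool}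
    (hgh : of g = of h)
    (H : ∀ i, ((g i).1 = x.1 ↔ (h i).1 = y.1) ∧ (g i = x ↔ h i = y)) :
    of (j.insertNth (α := fun _ => ℕ × Bool) x g) =
      of (j.insertNth (α := fun _ => ℕ × Bool) y h) := by
  rw [of_eq_of_iff] at hgh ⊢
  intro a b
  rcases j.eq_self_or_eq_succAbove a with ha | ⟨a, rfl⟩
  · rcases j.eq_self_or_eq_succAbove b with hb | ⟨b, rfl⟩
    · simp [ha, hb]
    · simp only [ha, Fin.insertNth_apply_same, Fin.insertNth_apply_succAbove]
      exact ⟨by rw [eq_comm, (H b).1, eq_comm], by rw [eq_comm, (H b).2, eq_comm]⟩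
  · rcases j.eq_self_or_eq_succAbove b with hb | ⟨b, rfl⟩
    · simp only [hb, Fin.insertNth_apply_same, Fin.insertNth_apply_succAbove]
      exact H a
    · simp only [Fin.insertNth_apply_succAbove]
      exact hgh a b

theorem vars_insertNth {n : ℕ} (j : Fin (n + 1)) (x : ℕ × Bool) (g : Fin n → ℕ × Bool) :
    vars (of (j.insertNth (α := fun _ => ℕ × Bool) x g)) =
      if ∃ i, (g i).1 = x.1 then vars (of g) else vars (of g) + 1 := by
  have hr : (Set.range fun i => (j.insertNth (α := fun _ => ℕ × Bool) x g i).1) =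
      insert x.1 (Set.range fun i => (g i).1) := by
    ext v
    simp [Fin.exists_iff_succAbove j, eq_comm]
  rw [vars_of, vars_of, hr]
  split_ifs with h
  · rw [Set.insert_eq_of_mem (by simpa using h)]
  · rw [Set.ncard_insert_of_notMem (by simpa using h)]

theorem insertNth_eta {n : ℕ} (j : Fin (n + 1)) (g : Fin (n + 1) → ℕ × Bool) :
    j.insertNth (α := fun _ => ℕ × Bool) (g j) (g ∘ j.succAbove) = g := by
  funext a
  rcases j.eq_self_or_eq_succAbove a with rfl | ⟨a, rfl⟩ <;> simp

theorem eq_of_opp {x y z : ℕ × Bool} (h : x.1 = y.1 ∧ x ≠ y) : z = y ↔ z.1 = x.1 ∧ z ≠ x := by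
  obtain ⟨x, a⟩ := x
  obtain ⟨y, b⟩ := y
  obtain ⟨z, c⟩ := z
  obtain ⟨rfl, h⟩ := h
  cases a <;> cases b <;> cases c <;> simp_all

theorem del_injOn_opp {n : ℕ} (i : Fin n) (j : Fin (n + 1)) :
    Set.InjOn (del j) {c | Opp c (j.succAbove i) j} := by
  intro c hc d hd hcd
  obtain ⟨g, rfl⟩ := exists_of c
  obtain ⟨h, rfl⟩ := exists_of d
  rw [← insertNth_eta j g, ← insertNth_eta j h]
  have hgh := of_eq_of_iff.1 hcd
  refine of_insertNth_congr j hcd fun a => ⟨?_, ?_⟩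
  · rw [← hc.1, ← hd.1]
    exact (hgh a i).1
  · rw [eq_of_opp hc, eq_of_opp hd]
    exact and_congr (hgh a i).1 (not_congr (hgh a i).2)

theorem vars_del {n : ℕ} {i : Fin n} {j : Fin (n + 1)} {c : LabelClass (n + 1)}
    (hc : Opp c (j.succAbove i) j) : vars (del j c) = vars c := by
  obtain ⟨g, rfl⟩ := exists_of c
  conv_rhs => rw [← insertNth_eta j g]
  rw [vars_insertNth, if_pos ⟨i, hc.1⟩]
  rfl

theorem exists_del_eq {n : ℕ} (i : Fin n) (j : Fin (n + 1)) (d : LabelClass n) :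
    ∃ c, Opp c (j.succAbove i) j ∧ del j c = d := by
  obtain ⟨h, rfl⟩ := exists_of d
  refine ⟨of (j.insertNth (α := fun _ => ℕ × Bool) ((h i).1, !(h i).2) h), ?_, ?_⟩
  · rw [opp_of]
    simp [Prod.ext_iff]
  · rw [del_of]
    congr 1
    funext a
    simp

/-- The number of classes of labellings with at most `K` variables. -/
noncomputable def count (n K : ℕ) : ℕ :=
  (Finset.univ.filter fun c : LabelClass n => vars c ≤ K).card

theorem card_opp {n K : ℕ} {i j : Fin (n + 1)} (hij : i ≠ j) :
    (Finset.univ.filter fun c : LabelClass (n + 1) => vars c ≤ K ∧ Opp c i j).card =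
      count n K := by
  obtain ⟨i, rfl⟩ := Fin.exists_succAbove_eq hij
  refine Finset.card_bij (fun c _ => del j c) ?_ ?_ ?_
  · intro c hc
    simp only [Finset.mem_filter, Finset.mem_univ, true_and] at hc ⊢
    rw [vars_del hc.2]
    exact hc.1
  · intro c hc d hd hcd
    simp only [Finset.mem_filter, Finset.mem_univ, true_and] at hc hd
    exact del_injOn_opp i j hc.2 hd.2 hcd
  · intro d hd
    simp only [Finset.mem_filter, Finset.mem_univ, true_and] at hd
    obtain ⟨c, hc, rfl⟩ := exists_del_eq i j d
    exact ⟨c, by simpa [hc, ← vars_del hc] using hd, rfl⟩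

theorem card_opp_opp_le_aux {n K : ℕ} {i j a b : Fin (n + 2)} (hij : i ≠ j) (hab : a ≠ b)
    (haj : a ≠ j) (hbj : b ≠ j) :
    (Finset.univ.filter fun c : LabelClass (n + 2) =>
      vars c ≤ K ∧ Opp c i j ∧ Opp c a b).card ≤ count n K := by
  obtain ⟨i, rfl⟩ := Fin.exists_succAbove_eq hij
  obtain ⟨a, rfl⟩ := Fin.exists_succAbove_eq haj
  obtain ⟨b, rfl⟩ := Fin.exists_succAbove_eq hbj
  rw [← card_opp (i := a) (j := b) (fun h => hab (by rw [h]))]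
  refine Finset.card_le_card_of_injOn (del j) ?_ ?_
  · intro c hc
    simp only [Finset.coe_filter, Finset.mem_univ, true_and, Set.mem_ofPred_eq] at hc ⊢
    rw [vars_del hc.2.1, opp_del]
    exact ⟨hc.1, hc.2.2⟩
  · intro c hc d hd hcd
    simp only [Finset.coe_filter, Finset.mem_univ, true_and, Set.mem_ofPred_eq] at hc hd
    exact del_injOn_opp i j hc.2.1 hd.2.1 hcd

theorem card_opp_opp_le {n K : ℕ} {i j a b : Fin (n + 2)} (hij : i < j) (hab : a < b)
    (h : (i, j) ≠ (a, b)) :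
    (Finset.univ.filter fun c : LabelClass (n + 2) =>
      vars c ≤ K ∧ Opp c i j ∧ Opp c a b).card ≤ count n K := by
  by_cases hj : a ≠ j ∧ b ≠ j
  · exact card_opp_opp_le_aux hij.ne hab.ne hj.1 hj.2
  · have hi : a ≠ i ∧ b ≠ i := by
      by_contra hi
      grind
    refine le_trans (Finset.card_le_card ?_) (card_opp_opp_le_aux hij.ne' hab.ne hi.1 hi.2)
    intro c hc
    simp only [Finset.mem_filter, Finset.mem_univ, true_and] at hc ⊢
    exact ⟨hc.1, hc.2.1.symm, hc.2.2⟩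

/-- The number of classes of labellings with exactly `p` variables. -/
noncomputable def countEq (n p : ℕ) : ℕ :=
  (Finset.univ.filter fun c : LabelClass n => vars c = p).card

theorem card_fiber_del {n p : ℕ} (d : LabelClass n) :
    (Finset.univ.filter fun c : LabelClass (n + 1) => vars c = p + 1 ∧ del 0 c = d).card =
      (if vars d = p + 1 then 2 * (p + 1) else 0) + (if vars d = p then 1 else 0) := by
  obtain ⟨h, rfl⟩ := exists_of d
  let I : ℕ × Bool → LabelClass (n + 1) :=
    fun x => of ((0 : Fin (n + 1)).insertNth (α := fun _ => ℕ × Bool) x h)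
  have hdel : ∀ x, del 0 (I x) = of h := by
    intro x
    change of _ = of h
    congr 1
  let V : Finset ℕ := Finset.univ.image fun i => (h i).1
  have hV : V.card = vars (of h) := by
    rw [vars_of, ← Set.ncard_coe_finset]
    congr 1
    ext v
    simp [V]
  have hmemV : ∀ v, v ∈ V ↔ ∃ i, (h i).1 = v := by simp [V]
  obtain ⟨w, hw⟩ := Infinite.exists_notMem_finset V
  have hfresh : ∀ x : ℕ × Bool, x.1 ∉ V → I x = I (w, true) := by
    intro x hx
    rw [hmemV] at hx hw
    refine of_insertNth_congr 0 rfl fun i => ⟨?_, ?_⟩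
    · exact ⟨fun e => (hx ⟨i, e⟩).elim, fun e => (hw ⟨i, e⟩).elim⟩
    · exact ⟨fun e => (hx ⟨i, by rw [e]⟩).elim, fun e => (hw ⟨i, by rw [e]⟩).elim⟩
  have hvI : ∀ x, vars (I x) = if x.1 ∈ V then vars (of h) else vars (of h) + 1 := by
    intro x
    simp only [I, vars_insertNth, hmemV]
  have hinj : ∀ x y : ℕ × Bool, x.1 ∈ V → I x = I y → x = y := by
    intro x y hx hxy
    obtain ⟨i, hi⟩ := (hmemV _).1 hx
    have H := of_eq_of_iff.1 hxy ((0 : Fin (n + 1)).succAbove i) 0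
    simp only [Fin.insertNth_apply_same, Fin.insertNth_apply_succAbove] at H
    by_cases hix : h i = x
    · rw [← hix]
      exact H.2.1 hix
    · rw [eq_of_opp (x := h i) ⟨H.1.1 hi, fun e => hix (H.2.2 e)⟩]
      exact ⟨hi.symm, fun e => hix e.symm⟩
  have hsurj : ∀ c, del 0 c = of h → ∃ x, I x = c := by
    intro c hc
    obtain ⟨g, rfl⟩ := exists_of c
    rw [del_of] at hc
    have H := of_eq_of_iff.1 hc
    by_cases hex : ∃ i, ((g ∘ (0 : Fin (n + 1)).succAbove) i).1 = (g 0).1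
    · obtain ⟨i, hi⟩ := hex
      by_cases hi' : (g ∘ (0 : Fin (n + 1)).succAbove) i = g 0
      · refine ⟨h i, ?_⟩
        rw [← insertNth_eta 0 g]
        refine of_insertNth_congr 0 hc.symm fun a => ?_
        rw [← hi']
        exact ⟨(H a i).1.symm, (H a i).2.symm⟩
      · refine ⟨((h i).1, !(h i).2), ?_⟩
        rw [← insertNth_eta 0 g]
        refine of_insertNth_congr 0 hc.symm fun a => ⟨?_, ?_⟩
        · rw [← hi]
          exact (H a i).1.symm
        · rw [eq_of_opp (x := h i) (by simp [Prod.ext_iff]), eq_of_opp ⟨hi, hi'⟩]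
          exact and_congr (H a i).1.symm (not_congr (H a i).2.symm)
    · refine ⟨(w, true), ?_⟩
      rw [← insertNth_eta 0 g]
      rw [hmemV] at hw
      refine of_insertNth_congr 0 hc.symm fun i => ⟨?_, ?_⟩
      · exact ⟨fun e => (hw ⟨i, e⟩).elim, fun e => (hex ⟨i, e⟩).elim⟩
      · exact ⟨fun e => (hw ⟨i, by rw [e]⟩).elim, fun e => (hex ⟨i, by rw [e]⟩).elim⟩
  have hset : (Finset.univ.filter fun c : LabelClass (n + 1) =>
      vars c = p + 1 ∧ del 0 c = of h) =
      (if vars (of h) = p + 1 then (V ×ˢ Finset.univ).image I else ∅) ∪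
        (if vars (of h) = p then {I (w, true)} else ∅) := by
    ext c
    simp only [Finset.mem_filter, Finset.mem_univ, true_and, Finset.mem_union]
    constructor
    · rintro ⟨hc, hd⟩
      obtain ⟨x, rfl⟩ := hsurj c hd
      rw [hvI] at hc
      split_ifs at hc with hx
      · left
        rw [if_pos hc]
        exact Finset.mem_image_of_mem _ (by simp [hx])
      · right
        rw [if_pos (by omega), hfresh x hx]
        simp
    · rintro (hc | hc)
      · split_ifs at hc with hp
        · obtain ⟨x, hx, rfl⟩ := Finset.mem_image.1 hc
          rw [hvI, if_pos (by simpa using hx)]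
          exact ⟨hp, hdel x⟩
        · simp at hc
      · split_ifs at hc with hp
        · rw [Finset.mem_singleton] at hc
          subst hc
          rw [hvI, if_neg hw]
          exact ⟨by omega, hdel _⟩
        · simp at hc
  rw [hset]
  by_cases h1 : vars (of h) = p + 1
  · have h2 : vars (of h) ≠ p := by omega
    rw [if_pos h1, if_neg h2, if_pos h1, if_neg h2, Finset.union_empty,
      Finset.card_image_of_injOn, Finset.card_product, hV, h1]
    · simp [mul_comm]
    · intro x hx y _ hxy
      exact hinj x y (by simpa using hx) hxy
  · rw [if_neg h1, if_neg h1, Finset.empty_union, zero_add]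
    split_ifs <;> simp

theorem countEq_succ_succ (n p : ℕ) :
    countEq (n + 1) (p + 1) = 2 * (p + 1) * countEq n (p + 1) + countEq n p := by
  have h : countEq (n + 1) (p + 1) = ∑ d : LabelClass n,
      (Finset.univ.filter fun c : LabelClass (n + 1) => vars c = p + 1 ∧ del 0 c = d).card := by
    rw [countEq, Finset.card_eq_sum_card_fiberwise (f := del 0) (t := Finset.univ)
      (fun _ _ => Finset.mem_coe.2 (Finset.mem_univ _))]
    simp only [Finset.filter_filter]
  rw [h, Finset.sum_congr rfl fun d _ => card_fiber_del d]
  simp only [Finset.sum_add_distrib, countEq, Finset.card_filter, Finset.mul_sum,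
    mul_ite, mul_one, mul_zero]

theorem countEq_zero_left (p : ℕ) : countEq 0 p = if p = 0 then 1 else 0 := by
  have hv : ∀ c : LabelClass 0, vars c = 0 := by
    intro c
    obtain ⟨g, rfl⟩ := exists_of c
    simp [vars_of]
  have hc : ∀ c d : LabelClass 0, c = d := by
    intro c d
    obtain ⟨g, rfl⟩ := exists_of c
    obtain ⟨h, rfl⟩ := exists_of d
    rw [Subsingleton.elim g h]
  simp only [countEq, hv]
  split_ifs with hp
  · subst hp
    rw [Finset.filter_true_of_mem (fun _ _ => rfl), Finset.card_eq_one]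
    exact ⟨of Fin.elim0, Finset.eq_singleton_iff_unique_mem.2
      ⟨Finset.mem_univ _, fun c _ => hc c _⟩⟩
  · simp [Ne.symm hp]

theorem countEq_succ_zero (n : ℕ) : countEq (n + 1) 0 = 0 := by
  rw [countEq, Finset.card_eq_zero, Finset.filter_eq_empty_iff]
  intro c _ hc
  obtain ⟨g, rfl⟩ := exists_of c
  rw [vars_of, Set.ncard_eq_zero] at hc
  simp at hc

theorem countEq_mul_two_pow (n p : ℕ) : countEq n p * 2 ^ p = 2 ^ n * stirling n p := by
  induction n generalizing p with
  | zero =>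
    rw [countEq_zero_left]
    cases p <;> simp [stirling]
  | succ n ih =>
    cases p with
    | zero => simp [countEq_succ_zero, stirling]
    | succ p =>
      have h1 := ih (p + 1)
      have h2 := ih p
      rw [countEq_succ_succ, stirling, add_mul, mul_assoc, h1]
      linear_combination 2 * h2

theorem count_eq_sum (n K : ℕ) : count n K = ∑ p ∈ Finset.range (K + 1), countEq n p := by
  rw [count, Finset.card_eq_sum_card_fiberwise (f := vars) (t := Finset.range (K + 1))]
  · refine Finset.sum_congr rfl fun p hp => ?_
    rw [Finset.filter_filter, countEq]
    congr 1
    ext c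
    simp only [Finset.mem_filter, Finset.mem_univ, true_and]
    have := Finset.mem_range.1 hp
    omega
  · intro c hc
    simp only [Finset.coe_filter, Finset.mem_univ, true_and, Set.mem_ofPred_eq] at hc
    simpa [Nat.lt_succ_iff] using hc

theorem count_eq (n K : ℕ) : (count (n + 1) K : ℝ) = 2 ^ (n + 1) * B (n + 1) K := by
  rw [count_eq_sum, Finset.sum_range_succ', countEq_succ_zero, add_zero, B, Finset.mul_sum,
    Finset.range_eq_Ico, Finset.sum_Ico_add' (fun p => countEq (n + 1) p) 0 K 1]
  push_cast
  refine Finset.sum_congr (by ext; simp) fun p _ => ?_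
  have h : (countEq (n + 1) p : ℝ) * 2 ^ p = 2 ^ (n + 1) * stirling (n + 1) p := by
    exact_mod_cast countEq_mul_two_pow (n + 1) p
  field_simp
  linarith

end LabelClass

end Labellings

section Bonferroni

open scoped Classical

theorem card_filter_exists_le {α β : Type*} (C : Finset α) (P : Finset β) (R : α → β → Prop) :
    (C.filter fun c => ∃ e ∈ P, R c e).card ≤ ∑ e ∈ P, (C.filter fun c => R c e).card := by
  refine le_trans (Finset.card_le_card ?_) Finset.card_biUnion_le
  intro c hc
  obtain ⟨hc, e, he, h⟩ := Finset.mem_filter.1 hc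
  exact Finset.mem_biUnion.2 ⟨e, he, Finset.mem_filter.2 ⟨hc, h⟩⟩

theorem sum_card_filter_le {α β : Type*} (C : Finset α) (P : Finset β) (R : α → β → Prop) :
    ∑ e ∈ P, (C.filter fun c => R c e).card ≤
      (C.filter fun c => ∃ e ∈ P, R c e).card +
        ∑ p ∈ P.offDiag, (C.filter fun c => R c p.1 ∧ R c p.2).card := by
  simp only [Finset.card_filter]
  rw [Finset.sum_comm, Finset.sum_comm (s := P.offDiag), ← Finset.sum_add_distrib]
  refine Finset.sum_le_sum fun c _ => ?_
  simp only [← Finset.card_filter]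
  have h : P.offDiag.filter (fun p => R c p.1 ∧ R c p.2) = (P.filter (R c)).offDiag := by
    ext p
    simp only [Finset.mem_filter, Finset.mem_offDiag]
    tauto
  rw [h, Finset.offDiag_card]
  obtain hq | ⟨e, he⟩ := (P.filter (R c)).eq_empty_or_nonempty
  · simp [hq]
  · rw [if_pos ⟨e, Finset.mem_filter.1 he⟩]
    generalize (P.filter (R c)).card = q
    rcases q with _ | _ | q
    · simp
    · simp
    · rw [← Nat.sub_one_mul]
      simp only [Nat.add_sub_cancel]
      nlinarith

theorem card_filter_lt_eq_choose {α : Type*} [LinearOrder α] (s : Finset α) :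
    ((s ×ˢ s).filter fun p => p.1 < p.2).card = s.card.choose 2 := by
  rw [← Finset.card_powersetCard]
  refine Finset.card_bij (fun p _ => {p.1, p.2}) ?_ ?_ ?_
  · rintro ⟨a, b⟩ h
    simp only [Finset.mem_filter, Finset.mem_product] at h
    rw [Finset.mem_powersetCard]
    exact ⟨by grind, Finset.card_pair h.2.ne⟩
  · rintro ⟨a, b⟩ h ⟨c, d⟩ h' e
    simp only [Finset.mem_filter, Finset.mem_product] at h h'
    simp only [Finset.ext_iff, Finset.mem_insert, Finset.mem_singleton] at e
    have h1 := (e a).1 (Or.inl rfl)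
    have h2 := (e b).1 (Or.inr rfl)
    have h3 := (e c).2 (Or.inl rfl)
    rcases h1 with rfl | rfl
    · rcases h2 with rfl | rfl
      · exact absurd h.2 (lt_irrefl _)
      · rfl
    · rcases h2 with rfl | rfl
      · exact absurd h.2 (not_lt_of_gt h'.2)
      · exact absurd h.2 (lt_irrefl _)
  · intro t ht
    obtain ⟨hts, ht⟩ := Finset.mem_powersetCard.1 ht
    obtain ⟨a, b, hab, rfl⟩ := Finset.card_eq_two.1 ht
    rcases lt_or_gt_of_ne hab with h | h
    · exact ⟨(a, b), by grind, rfl⟩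
    · exact ⟨(b, a), by grind, Finset.pair_comm _ _⟩

theorem choose_two_mul_self_sub (x : ℕ) :
    x.choose 2 * x.choose 2 - x.choose 2 = 6 * (x.choose 3 + x.choose 4) := by
  rcases x with _ | _ | x
  · rfl
  · rfl
  have h4 : (x + 2).choose 3 + (x + 2).choose 4 = (x + 3).choose 4 := rfl
  rw [h4, Nat.sub_eq_iff_eq_add (Nat.le_mul_self _)]
  have e2 : (x + 1) * (x + 2) = 2 * (x + 2).choose 2 := by
    simpa [Nat.succ_descFactorial_succ, Nat.factorial] using
      Nat.descFactorial_eq_factorial_mul_choose (x + 2) 2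
  have e4 : x * ((x + 1) * ((x + 2) * (x + 3))) = 24 * (x + 3).choose 4 := by
    simpa [Nat.succ_descFactorial_succ, Nat.factorial] using
      Nat.descFactorial_eq_factorial_mul_choose (x + 3) 4
  zify at e2 e4 ⊢
  have h : (4 : ℤ) * ((x + 2).choose 2 * (x + 2).choose 2) =
      4 * (6 * (x + 3).choose 4 + (x + 2).choose 2) := by
    linear_combination (2 - (2 * ((x + 2).choose 2 : ℤ) + (x + 2) * (x + 1))) * e2 + e4
  linarith

namespace LabelClass

/-- The classes of labellings with at most `K` variables for which two of the positions in `J`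
carry opposite literals. -/
noncomputable def conflicts (n K : ℕ) (J : Finset ℕ) : Finset (LabelClass n) :=
  Finset.univ.filter fun c => vars c ≤ K ∧ ∃ i j : Fin n, ↑i ∈ J ∧ ↑j ∈ J ∧ Opp c i j

theorem conflicts_bounds {n : ℕ} (K : ℕ) {J : Finset ℕ} (hJ : ∀ i ∈ J, i < n + 2) :
    (conflicts (n + 2) K J).card ≤ J.card.choose 2 * count (n + 1) K ∧
      J.card.choose 2 * count (n + 1) K ≤ (conflicts (n + 2) K J).card +
        6 * (J.card.choose 3 + J.card.choose 4) * count n K := by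
  set I := J.attachFin hJ with hI
  set P := (I ×ˢ I).filter fun p => p.1 < p.2 with hP
  set C := Finset.univ.filter fun c : LabelClass (n + 2) => vars c ≤ K with hC
  have hPcard : P.card = J.card.choose 2 := by
    rw [hP, card_filter_lt_eq_choose, hI, Finset.card_attachFin]
  have hset : conflicts (n + 2) K J = C.filter fun c => ∃ e ∈ P, Opp c e.1 e.2 := by
    ext c
    simp only [conflicts, hC, hP, hI, Finset.mem_filter, Finset.mem_univ, true_and,
      Finset.mem_product, Finset.mem_attachFin]
    refine and_congr_right fun _ => ⟨?_, ?_⟩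
    · rintro ⟨i, j, hi, hj, h⟩
      rcases lt_or_gt_of_ne h.ne with hij | hij
      · exact ⟨(i, j), ⟨⟨hi, hj⟩, hij⟩, h⟩
      · exact ⟨(j, i), ⟨⟨hj, hi⟩, hij⟩, h.symm⟩
    · rintro ⟨⟨i, j⟩, ⟨⟨hi, hj⟩, _⟩, h⟩
      exact ⟨i, j, hi, hj, h⟩
  have hsum : ∑ e ∈ P, (C.filter fun c => Opp c e.1 e.2).card =
      J.card.choose 2 * count (n + 1) K := by
    rw [← hPcard, ← smul_eq_mul, ← Finset.sum_const]
    refine Finset.sum_congr rfl fun e he => ?_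
    rw [hC, Finset.filter_filter]
    exact card_opp (Finset.mem_filter.1 he).2.ne
  rw [hset, ← hsum]
  refine ⟨card_filter_exists_le _ _ _, (sum_card_filter_le _ _ _).trans ?_⟩
  gcongr
  rw [← choose_two_mul_self_sub, ← hPcard, ← Finset.offDiag_card, ← smul_eq_mul]
  refine Finset.sum_le_card_nsmul _ _ _ fun p hp => ?_
  obtain ⟨h1, h2, hne⟩ := Finset.mem_offDiag.1 hp
  rw [hC, Finset.filter_filter]
  exact card_opp_opp_le (Finset.mem_filter.1 h1).2 (Finset.mem_filter.1 h2).2 hne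

end LabelClass

end Bonferroni

section Shapes

open scoped Classical

/-- The connective exchanged with the given one by duality. -/
def Conn.dual : Conn → Conn
  | .and => .or
  | .or => .and

namespace Shape

theorem one_le_size : ∀ s : Shape, 1 ≤ s.size
  | .leaf => le_rfl
  | .node _ l _ => le_add_right (one_le_size l)

/-- The tree-structures with `n` internal nodes. -/
noncomputable def ofNodes : ℕ → Finset Shape
  | 0 => {.leaf}
  | n + 1 => (Finset.HasAntidiagonal.antidiagonal n).attach.biUnion fun p =>
      (({Conn.and, Conn.or} : Finset Conn) ×ˢ ofNodes p.1.1 ×ˢ ofNodes p.1.2).image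
        fun x => .node x.1 x.2.1 x.2.2
  decreasing_by
    · exact Nat.lt_succ_of_le (Finset.HasAntidiagonal.antidiagonal.fst_le p.2)
    · exact Nat.lt_succ_of_le (Finset.HasAntidiagonal.antidiagonal.snd_le p.2)

theorem ofNodes_zero : ofNodes 0 = {.leaf} := by rw [ofNodes]

theorem ofNodes_succ (n : ℕ) : ofNodes (n + 1) = (Finset.HasAntidiagonal.antidiagonal n).biUnion fun p =>
    (({Conn.and, Conn.or} : Finset Conn) ×ˢ ofNodes p.1 ×ˢ ofNodes p.2).image
      fun x => .node x.1 x.2.1 x.2.2 := by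
  rw [ofNodes]
  ext s
  simp

theorem mem_ofNodes {n : ℕ} {s : Shape} : s ∈ ofNodes n ↔ s.size = n + 1 := by
  induction s generalizing n with
  | leaf =>
    cases n with
    | zero => simp [ofNodes_zero, size]
    | succ n => simp [ofNodes_succ, size]
  | node c l r ihl ihr =>
    have hl := one_le_size l
    have hr := one_le_size r
    cases n with
    | zero =>
      simp only [ofNodes_zero, Finset.mem_singleton, reduceCtorEq, size, false_iff]
      omega
    | succ n =>
      have hc : c = .and ∨ c = .or := by cases c <;> simp
      simp only [ofNodes_succ, Finset.mem_biUnion, Finset.mem_image, Finset.mem_product,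
        Finset.HasAntidiagonal.mem_antidiagonal, Prod.exists, Shape.node.injEq, size]
      constructor
      · rintro ⟨i, j, hij, c', l', r', ⟨-, h1, h2⟩, rfl, rfl, rfl⟩
        rw [ihl] at h1
        rw [ihr] at h2
        omega
      · intro h
        exact ⟨l.size - 1, r.size - 1, by omega, c, l, r,
          ⟨by simpa using hc, ihl.2 (by omega), ihr.2 (by omega)⟩, rfl, rfl, rfl⟩

theorem sum_ofNodes_succ {M : Type*} [AddCommMonoid M] (n : ℕ) (F : Shape → M) :
    ∑ s ∈ ofNodes (n + 1), F s = ∑ p ∈ Finset.HasAntidiagonal.antidiagonal n,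
      ∑ l ∈ ofNodes p.1, ∑ r ∈ ofNodes p.2, (F (.node .and l r) + F (.node .or l r)) := by
  rw [ofNodes_succ, Finset.sum_biUnion]
  · refine Finset.sum_congr rfl fun p _ => ?_
    rw [Finset.sum_image, Finset.sum_product, Finset.sum_pair (by simp), Finset.sum_product,
      Finset.sum_product, ← Finset.sum_add_distrib]
    · exact Finset.sum_congr rfl fun l _ => Finset.sum_add_distrib.symm
    · rintro ⟨c, l, r⟩ _ ⟨c', l', r'⟩ _ h
      simpa using h
  · intro p _ q _ hpq
    rw [Function.onFun, Finset.disjoint_left]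
    intro s hs hs'
    obtain ⟨⟨c, l, r⟩, h, rfl⟩ := Finset.mem_image.1 hs
    obtain ⟨⟨c', l', r'⟩, h', e⟩ := Finset.mem_image.1 hs'
    simp only [Shape.node.injEq] at e
    obtain ⟨rfl, rfl, rfl⟩ := e
    simp only [Finset.mem_product, mem_ofNodes] at h h'
    exact hpq (Prod.ext (by omega) (by omega))

/-- The positions of the leaves linked to the root through `c`-labelled nodes only. -/
noncomputable def linked (c : Conn) : Shape → Finset ℕ
  | .leaf => {0}
  | .node d l r =>
      if d = c then linked c l ∪ (linked c r).map (addLeftEmbedding l.size) else ∅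

theorem lt_size_of_mem_linked {c : Conn} {s : Shape} {i : ℕ} (hi : i ∈ linked c s) :
    i < s.size := by
  induction s generalizing i with
  | leaf => simpa [linked, size] using hi
  | node d l r ihl ihr =>
    rw [linked] at hi
    split_ifs at hi
    · rw [Finset.mem_union, Finset.mem_map] at hi
      rcases hi with hi | ⟨j, hj, rfl⟩
      · exact (ihl hi).trans_le (Nat.le_add_right _ _)
      · exact Nat.add_lt_add_left (ihr hj) _
    · simp at hi

theorem card_linked_node (c d : Conn) (l r : Shape) :
    (linked c (.node d l r)).card =
      if d = c then (linked c l).card + (linked c r).card else 0 := by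
  rw [linked]
  split_ifs
  · rw [Finset.card_union_of_disjoint, Finset.card_map]
    rw [Finset.disjoint_left]
    intro i hi hi'
    obtain ⟨j, _, rfl⟩ := Finset.mem_map.1 hi'
    exact absurd (lt_size_of_mem_linked hi) (by simp)
  · rfl

/-- In a tree-structure with a leaf below the root, the positions of the leaves of the other
subtree that are linked to its root through connectives dual to that of the root. -/
noncomputable def besideLeaf : Shape → Finset ℕ
  | .node c .leaf r => (linked c.dual r).map (addLeftEmbedding 1)
  | .node c (.node d l r) .leaf => linked c.dual (.node d l r)
  | .node _ (.node _ _ _) (.node _ _ _) => ∅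
  | .leaf => ∅

theorem lt_size_of_mem_besideLeaf {s : Shape} {i : ℕ} (hi : i ∈ besideLeaf s) :
    i < s.size := by
  rcases s with _ | ⟨c, _ | ⟨d, l, r⟩, _ | ⟨d', l', r'⟩⟩ <;> rw [besideLeaf] at hi
  · simp at hi
  · obtain ⟨j, hj, rfl⟩ := Finset.mem_map.1 hi
    exact Nat.add_lt_add_left (lt_size_of_mem_linked hj) _
  · obtain ⟨j, hj, rfl⟩ := Finset.mem_map.1 hi
    exact Nat.add_lt_add_left (lt_size_of_mem_linked hj) _
  · exact (lt_size_of_mem_linked hi).trans_le (Nat.le_add_right _ _)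
  · simp at hi

/-- The factorial moments of the number of linked leaves, as a power series in the number of
internal nodes. -/
noncomputable def linkedSeries (c : Conn) (j : ℕ) : PowerSeries ℝ :=
  PowerSeries.mk fun n => ∑ s ∈ ofNodes n, ((linked c s).card.choose j : ℝ)

theorem linkedSeries_eq (c : Conn) (j : ℕ) :
    linkedSeries c j = PowerSeries.C ((Nat.choose 1 j : ℕ) : ℝ) + PowerSeries.X *
      (∑ p ∈ Finset.HasAntidiagonal.antidiagonal j, linkedSeries c p.1 * linkedSeries c p.2 +
        if j = 0 then linkedSeries c 0 * linkedSeries c 0 else 0) := by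
  ext n
  cases n with
  | zero => simp [linkedSeries, ofNodes_zero, linked]
  | succ n =>
    have hnode : ∀ l r : Shape, ((linked c (.node .and l r)).card.choose j : ℝ) +
        ((linked c (.node .or l r)).card.choose j : ℝ) =
        ∑ p ∈ Finset.HasAntidiagonal.antidiagonal j,
          ((linked c l).card.choose p.1 : ℝ) * ((linked c r).card.choose p.2 : ℝ) +
          if j = 0 then 1 else 0 := by
      intro l r
      have h0 : ((Nat.choose 0 j : ℕ) : ℝ) = if j = 0 then 1 else 0 := by
        cases j <;> simp
      have h1 : (((linked c l).card + (linked c r).card).choose j : ℝ) =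
          ∑ p ∈ Finset.HasAntidiagonal.antidiagonal j,
            ((linked c l).card.choose p.1 : ℝ) * ((linked c r).card.choose p.2 : ℝ) := by
        rw [Nat.add_choose_eq]
        push_cast
        rfl
      rw [card_linked_node, card_linked_node, ← h0, ← h1]
      cases c <;> simp [add_comm]
    have hmul : ∀ i k, PowerSeries.coeff n (linkedSeries c i * linkedSeries c k) =
        ∑ p ∈ Finset.HasAntidiagonal.antidiagonal n, ∑ l ∈ ofNodes p.1, ∑ r ∈ ofNodes p.2,
          ((linked c l).card.choose i : ℝ) * ((linked c r).card.choose k : ℝ) := by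
      intro i k
      rw [PowerSeries.coeff_mul]
      refine Finset.sum_congr rfl fun p _ => ?_
      rw [linkedSeries, linkedSeries, PowerSeries.coeff_mk, PowerSeries.coeff_mk,
        Finset.sum_mul_sum]
    rw [map_add, PowerSeries.coeff_succ_X_mul, PowerSeries.coeff_C, if_neg (Nat.succ_ne_zero n),
      zero_add, map_add, map_sum]
    simp only [hmul]
    rw [linkedSeries, PowerSeries.coeff_mk, sum_ofNodes_succ]
    simp only [hnode, Finset.sum_add_distrib]
    congr 1
    · rw [Finset.sum_comm (s := Finset.HasAntidiagonal.antidiagonal j)]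
      refine Finset.sum_congr rfl fun p _ => ?_
      rw [Finset.sum_comm (s := Finset.HasAntidiagonal.antidiagonal j)]
      refine Finset.sum_congr rfl fun l _ => ?_
      rw [Finset.sum_comm]
    · split_ifs
      · rw [hmul]
        simp
      · simp

/-- The generating series of tree-structures by number of internal nodes. -/
noncomputable def series : PowerSeries ℝ := PowerSeries.mk fun n => ((ofNodes n).card : ℝ)

theorem linkedSeries_zero (c : Conn) : linkedSeries c 0 = series := by
  simp [linkedSeries, series]

theorem series_eq : series = 1 + PowerSeries.X * (2 * series ^ 2) := by
  have h := linkedSeries_eq .and 0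
  simp [linkedSeries_zero] at h
  linear_combination h

theorem linkedSeries_one (c : Conn) : linkedSeries c 1 = series := by
  have h := linkedSeries_eq c 1
  simp [Finset.Nat.antidiagonal_succ, linkedSeries_zero] at h
  linear_combination series * h - linkedSeries c 1 * series_eq

theorem linkedSeries_two (c : Conn) : linkedSeries c 2 = PowerSeries.X * series ^ 3 := by
  have h := linkedSeries_eq c 2
  simp [Finset.Nat.antidiagonal_succ, linkedSeries_zero, linkedSeries_one] at h
  linear_combination series * h - linkedSeries c 2 * series_eq

theorem linkedSeries_three (c : Conn) :
    linkedSeries c 3 = PowerSeries.X ^ 2 * (2 * series ^ 5) := by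
  have h := linkedSeries_eq c 3
  simp [Finset.Nat.antidiagonal_succ, linkedSeries_zero, linkedSeries_one,
    linkedSeries_two, Nat.choose] at h
  linear_combination series * h - linkedSeries c 3 * series_eq

theorem linkedSeries_four (c : Conn) :
    linkedSeries c 4 = PowerSeries.X ^ 3 * (5 * series ^ 7) := by
  have h := linkedSeries_eq c 4
  simp [Finset.Nat.antidiagonal_succ, linkedSeries_zero, linkedSeries_one,
    linkedSeries_two, linkedSeries_three, Nat.choose] at h
  linear_combination series * h - linkedSeries c 4 * series_eq

theorem coeff_series (n : ℕ) : PowerSeries.coeff n series = 2 ^ n * catalan n := by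
  induction n using Nat.strong_induction_on with
  | _ n ih =>
    rw [series_eq]
    cases n with
    | zero => simp
    | succ n =>
      rw [map_add, PowerSeries.coeff_succ_X_mul, PowerSeries.coeff_one, if_neg (by simp),
        zero_add, two_mul, map_add, ← two_mul, pow_two, PowerSeries.coeff_mul, catalan_succ']
      push_cast
      rw [Finset.mul_sum, Finset.mul_sum]
      refine Finset.sum_congr rfl fun p hp => ?_
      rw [Finset.HasAntidiagonal.mem_antidiagonal] at hp
      rw [ih p.1 (by omega), ih p.2 (by omega), ← hp]
      ring

theorem card_ofNodes (n : ℕ) : ((ofNodes n).card : ℝ) = 2 ^ n * catalan n := by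
  rw [← coeff_series, series, PowerSeries.coeff_mk]

theorem coeff_series_pow_nonneg (j n : ℕ) : 0 ≤ PowerSeries.coeff n (series ^ j) := by
  induction j generalizing n with
  | zero =>
    rw [pow_zero, PowerSeries.coeff_one]
    split_ifs <;> simp
  | succ j ih =>
    rw [pow_succ, PowerSeries.coeff_mul]
    refine Finset.sum_nonneg fun p _ => mul_nonneg (ih _) ?_
    rw [coeff_series]
    positivity

theorem two_mul_coeff_series_pow (j n : ℕ) :
    2 * PowerSeries.coeff n (series ^ (j + 2)) =
      PowerSeries.coeff (n + 1) (series ^ (j + 1)) - PowerSeries.coeff (n + 1) (series ^ j) := by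
  have h : series ^ (j + 1) - series ^ j =
      PowerSeries.X * (series ^ (j + 2) + series ^ (j + 2)) := by
    linear_combination series ^ j * series_eq
  rw [← map_sub, h, PowerSeries.coeff_succ_X_mul, map_add, two_mul]

theorem two_mul_coeff_series_pow_le (j n : ℕ) :
    2 * PowerSeries.coeff n (series ^ (j + 2)) ≤
      PowerSeries.coeff (n + 1) (series ^ (j + 1)) := by
  rw [two_mul_coeff_series_pow]
  linarith [coeff_series_pow_nonneg j (n + 1)]

theorem coeff_series_succ_mul (n : ℕ) :
    (n + 2) * PowerSeries.coeff (n + 1) series =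
      (8 * n + 4) * PowerSeries.coeff n series := by
  have h1 := succ_mul_catalan_eq_centralBinom n
  have h2 := succ_mul_catalan_eq_centralBinom (n + 1)
  have h3 := Nat.succ_mul_centralBinom_succ n
  rw [← h1, ← h2] at h3
  have h4 : ((n + 1) * ((n + 1 + 1) * catalan (n + 1)) : ℝ) =
      2 * (2 * n + 1) * ((n + 1) * catalan n) := by exact_mod_cast h3
  have h5 : ((n : ℝ) + 1) ≠ 0 := by positivity
  have h6 : ((n + 2) * catalan (n + 1) : ℝ) = 2 * (2 * n + 1) * catalan n := by
    apply mul_left_cancel₀ h5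
    linear_combination h4
  rw [coeff_series, coeff_series, pow_succ]
  linear_combination 2 ^ n * 2 * h6

theorem coeff_series_pos (n : ℕ) : 0 < PowerSeries.coeff n series := by
  rw [coeff_series]
  have h := succ_mul_catalan_eq_centralBinom n
  have : 0 < catalan n := by
    refine Nat.pos_of_ne_zero fun h0 => ?_
    rw [h0, mul_zero] at h
    exact (Nat.centralBinom_ne_zero n) h.symm
  positivity

theorem coeff_series_succ_le (n : ℕ) :
    PowerSeries.coeff (n + 1) series ≤ 8 * PowerSeries.coeff n series := by
  have h := coeff_series_succ_mul n
  have h0 := coeff_series_pos n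
  have h1 : (0 : ℝ) < n + 2 := by positivity
  refine le_of_mul_le_mul_left ?_ h1
  rw [h]
  nlinarith

theorem coeff_linkedSeries_two (c : Conn) (m : ℕ) :
    PowerSeries.coeff (m + 3) (linkedSeries c 2) =
      PowerSeries.coeff (m + 4) series / 4 - PowerSeries.coeff (m + 3) series / 2 := by
  rw [linkedSeries_two, PowerSeries.coeff_succ_X_mul]
  have h1 := two_mul_coeff_series_pow 1 (m + 2)
  have h2 := two_mul_coeff_series_pow 0 (m + 3)
  simp only [zero_add, pow_one, pow_zero, PowerSeries.coeff_one] at h1 h2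
  rw [if_neg (by simp)] at h2
  norm_num at h1 h2
  linarith

theorem coeff_linkedSeries_three_le (c : Conn) (m : ℕ) :
    PowerSeries.coeff (m + 3) (linkedSeries c 3) ≤ PowerSeries.coeff (m + 4) series := by
  rw [linkedSeries_three, PowerSeries.coeff_X_pow_mul', if_pos (by omega), two_mul, map_add,
    show m + 3 - 2 = m + 1 by omega]
  have h1 := two_mul_coeff_series_pow_le 3 (m + 1)
  have h2 := two_mul_coeff_series_pow_le 2 (m + 2)
  have h3 := two_mul_coeff_series_pow_le 1 (m + 3)
  have h4 := two_mul_coeff_series_pow_le 0 (m + 4)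
  have h5 := coeff_series_succ_le (m + 4)
  rw [zero_add, pow_one] at h4
  norm_num at h1 h2 h3 h4 h5 ⊢
  linarith

theorem coeff_linkedSeries_four_le (c : Conn) (m : ℕ) :
    PowerSeries.coeff (m + 3) (linkedSeries c 4) ≤ 5 * PowerSeries.coeff (m + 4) series := by
  have hfive : (5 : PowerSeries ℝ) = PowerSeries.C (5 : ℝ) := (map_ofNat PowerSeries.C 5).symm
  rw [linkedSeries_four, PowerSeries.coeff_X_pow_mul', if_pos (by omega), hfive,
    PowerSeries.coeff_C_mul]
  have h1 := two_mul_coeff_series_pow_le 5 m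
  have h2 := two_mul_coeff_series_pow_le 4 (m + 1)
  have h3 := two_mul_coeff_series_pow_le 3 (m + 2)
  have h4 := two_mul_coeff_series_pow_le 2 (m + 3)
  have h5 := two_mul_coeff_series_pow_le 1 (m + 4)
  have h6 := two_mul_coeff_series_pow_le 0 (m + 5)
  have h7 := coeff_series_succ_le (m + 4)
  have h8 := coeff_series_succ_le (m + 5)
  rw [zero_add, pow_one] at h6
  norm_num at h1 h2 h3 h4 h5 h6 h7 h8 ⊢
  linarith

theorem card_besideLeaf_leaf_left (c : Conn) (r : Shape) :
    (besideLeaf (.node c .leaf r)).card = (linked c.dual r).card := by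
  rw [besideLeaf, Finset.card_map]

theorem sum_choose_besideLeaf (m j : ℕ) (hj : j ≠ 0) :
    ∑ s ∈ ofNodes (m + 4), ((besideLeaf s).card.choose j : ℝ) =
      2 * (PowerSeries.coeff (m + 3) (linkedSeries .and j) +
        PowerSeries.coeff (m + 3) (linkedSeries .or j)) := by
  have hleft : ∀ r : Shape, ((besideLeaf (.node .and .leaf r)).card.choose j : ℝ) +
      ((besideLeaf (.node .or .leaf r)).card.choose j : ℝ) =
      ((linked .and r).card.choose j : ℝ) + ((linked .or r).card.choose j : ℝ) := by
    intro r
    rw [card_besideLeaf_leaf_left, card_besideLeaf_leaf_left, add_comm]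
    rfl
  have hright : ∀ l ∈ ofNodes (m + 3), ((besideLeaf (.node .and l .leaf)).card.choose j : ℝ) +
      ((besideLeaf (.node .or l .leaf)).card.choose j : ℝ) =
      ((linked .and l).card.choose j : ℝ) + ((linked .or l).card.choose j : ℝ) := by
    intro l hl
    rcases l with _ | ⟨c, l, r⟩
    · simp [mem_ofNodes, size] at hl
    · rw [besideLeaf, besideLeaf, add_comm]
      rfl
  have hmid : ∀ p ∈ Finset.HasAntidiagonal.antidiagonal (m + 1), ∑ l ∈ ofNodes (p.1 + 1),
      ∑ r ∈ ofNodes (p.2 + 1), (((besideLeaf (.node .and l r)).card.choose j : ℝ) +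
        ((besideLeaf (.node .or l r)).card.choose j : ℝ)) = 0 := by
    intro p _
    refine Finset.sum_eq_zero fun l hl => Finset.sum_eq_zero fun r hr => ?_
    rcases l with _ | ⟨c, l, l'⟩
    · simp [mem_ofNodes, size] at hl
    rcases r with _ | ⟨d, r, r'⟩
    · simp [mem_ofNodes, size] at hr
    obtain ⟨j, rfl⟩ := Nat.exists_eq_succ_of_ne_zero hj
    simp [besideLeaf]
  rw [sum_ofNodes_succ, Finset.Nat.sum_antidiagonal_succ, Finset.Nat.sum_antidiagonal_succ']
  simp only [ofNodes_zero, Finset.sum_singleton]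
  rw [Finset.sum_eq_zero hmid, Finset.sum_congr rfl fun r _ => hleft r,
    Finset.sum_congr rfl hright, linkedSeries, linkedSeries, PowerSeries.coeff_mk,
    PowerSeries.coeff_mk, Finset.sum_add_distrib]
  ring

end Shape

end Shapes

section Trees

open scoped Classical

namespace AOTree

theorem size_shape (t : AOTree) : t.shape.size = t.size := by
  induction t with
  | leaf => rfl
  | node c l r ihl ihr => simp_all [shape, Shape.size, size, leaves]

theorem lv_leaf (v : ℕ) (b : Bool) : lv (.leaf v b) 0 = (v, b) := rfl

theorem lv_node_of_lt (c : Conn) (l r : AOTree) {i : ℕ} (hi : i < l.shape.size) :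
    lv (.node c l r) i = lv l i := by
  rw [size_shape] at hi
  rw [lv, lv, leaves, List.getD_append _ _ _ _ hi]

theorem lv_node_add (c : Conn) (l r : AOTree) (i : ℕ) :
    lv (.node c l r) (l.shape.size + i) = lv r i := by
  rw [size_shape, size, lv, lv, leaves, List.getD_append_right _ _ _ _ (Nat.le_add_right _ _),
    Nat.add_sub_cancel_left]

/-- The tree with given structure whose leaves are labelled by the successive values of `g`. -/
def label : Shape → (ℕ → ℕ × Bool) → AOTree
  | .leaf, g => .leaf (g 0).1 (g 0).2
  | .node c l r, g => .node c (label l g) (label r fun i => g (l.size + i))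

theorem shape_label (s : Shape) (g : ℕ → ℕ × Bool) : (label s g).shape = s := by
  induction s generalizing g with
  | leaf => rfl
  | node c l r ihl ihr => rw [label, shape, ihl, ihr]

theorem lv_label {s : Shape} (g : ℕ → ℕ × Bool) {i : ℕ} (hi : i < s.size) :
    lv (label s g) i = g i := by
  induction s generalizing g i with
  | leaf =>
    obtain rfl : i = 0 := Nat.lt_one_iff.1 hi
    rfl
  | node c l r ihl ihr =>
    rw [label]
    rcases lt_or_ge i l.size with h | h
    · rw [lv_node_of_lt _ _ _ (by rwa [shape_label]), ihl _ h]
    · obtain ⟨j, rfl⟩ := Nat.exists_eq_add_of_le h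
      have hj : j < r.size := Nat.lt_of_add_lt_add_left hi
      have := lv_node_add c (label l g) (label r fun i => g (l.size + i)) j
      rw [shape_label] at this
      rw [this, ihr _ hj]

/-- The class of the labelling of the first `n` leaves. -/
def labelClass (n : ℕ) (t : AOTree) : LabelClass n := .of fun i => lv t i

theorem treeEquiv_iff {n : ℕ} {A B : AOTree} (hA : A.size = n) :
    TreeEquiv A B ↔ A.shape = B.shape ∧ labelClass n A = labelClass n B := by
  subst hA
  rw [TreeEquiv, labelClass, labelClass, LabelClass.of_eq_of_iff]
  refine and_congr_right fun _ => ⟨fun h i j => h i j i.2 j.2, fun h i j hi hj => ?_⟩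
  exact h ⟨i, hi⟩ ⟨j, hj⟩

theorem vars_labelClass {n : ℕ} {t : AOTree} (ht : t.size = n) :
    (labelClass n t).vars = t.varCount := by
  subst ht
  rw [labelClass, LabelClass.vars_of, varCount, ← Set.ncard_coe_finset]
  congr 1
  ext v
  simp only [Set.mem_range, List.coe_toFinset, List.mem_map, Set.mem_ofPred_eq]
  constructor
  · rintro ⟨i, rfl⟩
    refine ⟨_, List.getElem_mem i.2, ?_⟩
    rw [lv, List.getD_eq_getElem _ _ i.2]
  · rintro ⟨x, hx, rfl⟩
    obtain ⟨i, hi, rfl⟩ := List.mem_iff_getElem.1 hx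
    exact ⟨⟨i, hi⟩, by rw [lv, List.getD_eq_getElem _ _ hi]⟩

theorem classCount_eq_sum (n : ℕ) {P : AOTree → Prop} (Q : Shape → LabelClass (n + 1) → Prop)
    (hPQ : ∀ t, P t ↔ t.size = n + 1 ∧ Q t.shape (labelClass (n + 1) t)) :
    classCount P =
      ∑ s ∈ Shape.ofNodes n, (Finset.univ.filter fun c : LabelClass (n + 1) => Q s c).card := by
  set S := (Shape.ofNodes n).sigma fun s =>
    Finset.univ.filter fun c : LabelClass (n + 1) => Q s c with hS
  have hmem : ∀ x, x ∈ S ↔ x.1.size = n + 1 ∧ Q x.1 x.2 := by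
    simp [hS, Shape.mem_ofNodes]
  let F : {t : AOTree // P t} → S := fun t =>
    ⟨⟨t.1.shape, labelClass (n + 1) t.1⟩, (hmem _).2 (by rw [size_shape]; exact (hPQ _).1 t.2)⟩
  have hF : ∀ A B, TreeEquiv A.1 B.1 ↔ F A = F B := fun A B => by
    rw [treeEquiv_iff ((hPQ _).1 A.2).1]
    simp [F]
  have hbij : Function.Bijective (Quot.lift F fun A B h => (hF A B).1 h) := by
    constructor
    · rintro ⟨A⟩ ⟨B⟩ h
      exact Quot.sound ((hF A B).2 h)
    · rintro ⟨⟨s, c⟩, h⟩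
      obtain ⟨hs, hQ⟩ := (hmem _).1 h
      obtain ⟨g, rfl⟩ := LabelClass.exists_of c
      let g' : ℕ → ℕ × Bool := fun i => if h : i < n + 1 then g ⟨i, h⟩ else (0, true)
      have hc : labelClass (n + 1) (label s g') = .of g := by
        rw [labelClass]
        congr 1
        funext i
        rw [lv_label _ (i.2.trans_eq hs.symm)]
        exact dif_pos i.2
      have hP : P (label s g') := by
        rw [hPQ, ← size_shape, hc, shape_label]
        exact ⟨hs, hQ⟩
      refine ⟨Quot.mk _ ⟨_, hP⟩, Subtype.ext ?_⟩
      simp only [F, hc, shape_label]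
  rw [← Finset.card_sigma, ← hS, classCount, Nat.card_congr (Equiv.ofBijective _ hbij),
    Nat.card_eq_fintype_card, Fintype.card_coe]

/-- Two of the leaves at the given positions are labelled by a variable and its negation. -/
def HasConflict (t : AOTree) (J : Finset ℕ) : Prop :=
  ∃ i ∈ J, ∃ j ∈ J, (lv t i).1 = (lv t j).1 ∧ lv t i ≠ lv t j

theorem hasConflict_iff (t : AOTree) (J : Finset ℕ) :
    HasConflict t J ↔ ∃ v b, (∃ i ∈ J, lv t i = (v, b)) ∧ ∃ i ∈ J, lv t i = (v, !b) := by
  constructor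
  · rintro ⟨i, hi, j, hj, h, h'⟩
    refine ⟨_, _, ⟨i, hi, rfl⟩, j, hj, Prod.ext h.symm ?_⟩
    have : (lv t i).2 ≠ (lv t j).2 := fun e => h' (Prod.ext h e)
    exact Bool.eq_not_of_ne this.symm
  · rintro ⟨v, b, ⟨i, hi, hib⟩, j, hj, hjb⟩
    exact ⟨i, hi, j, hj, by rw [hib, hjb], by simp [hib, hjb]⟩

theorem exists_linked_node (c : Conn) (l r : AOTree) (x : ℕ × Bool) :
    (∃ i ∈ Shape.linked c (.node c l.shape r.shape), lv (.node c l r) i = x) ↔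
      (∃ i ∈ Shape.linked c l.shape, lv l i = x) ∨ ∃ i ∈ Shape.linked c r.shape, lv r i = x := by
  rw [Shape.linked, if_pos rfl]
  simp only [Finset.mem_union, Finset.mem_map, or_and_right, exists_or]
  refine or_congr (exists_congr fun i => and_congr_right fun hi => ?_) ?_
  · rw [lv_node_of_lt _ _ _ (Shape.lt_size_of_mem_linked hi)]
  · constructor
    · rintro ⟨_, ⟨i, hi, rfl⟩, h⟩
      exact ⟨i, hi, by rwa [addLeftEmbedding_apply, lv_node_add] at h⟩
    · rintro ⟨i, hi, h⟩
      exact ⟨_, ⟨i, hi, rfl⟩, by rwa [addLeftEmbedding_apply, lv_node_add]⟩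

theorem orLeaf_iff (t : AOTree) (x : ℕ × Bool) :
    orLeaf t x ↔ ∃ i ∈ Shape.linked .or t.shape, lv t i = x := by
  induction t with
  | leaf v b => simp [orLeaf, shape, Shape.linked, lv_leaf]
  | node c l r ihl ihr =>
    rw [shape]
    cases c
    · simp [orLeaf, Shape.linked]
    · rw [exists_linked_node, orLeaf, ihl, ihr]

theorem andLeaf_iff (t : AOTree) (x : ℕ × Bool) :
    andLeaf t x ↔ ∃ i ∈ Shape.linked .and t.shape, lv t i = x := by
  induction t with
  | leaf v b => simp [andLeaf, shape, Shape.linked, lv_leaf]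
  | node c l r ihl ihr =>
    rw [shape]
    cases c
    · rw [exists_linked_node, andLeaf, ihl, ihr]
    · simp [andLeaf, Shape.linked]

theorem isSimpleTautology_iff (t : AOTree) :
    IsSimpleTautology t ↔ HasConflict t (Shape.linked .or t.shape) := by
  simp only [IsSimpleTautology, orLeaf_iff, hasConflict_iff]

theorem isSimpleContradiction_iff (t : AOTree) :
    IsSimpleContradiction t ↔ HasConflict t (Shape.linked .and t.shape) := by
  simp only [IsSimpleContradiction, andLeaf_iff, hasConflict_iff]

theorem not_hasConflict_leaf (v : ℕ) (b : Bool) (c : Conn) :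
    ¬ HasConflict (.leaf v b) (Shape.linked c .leaf) := by
  rintro ⟨i, hi, j, hj, -, h⟩
  simp only [Shape.linked, Finset.mem_singleton] at hi hj
  exact h (by rw [hi, hj])

theorem isSimpleXT_node (c : Conn) (l r : AOTree) :
    IsSimpleXT (.node c l r) ↔
      (l.shape = .leaf ∧ HasConflict r (Shape.linked c.dual r.shape)) ∨
        (r.shape = .leaf ∧ HasConflict l (Shape.linked c.dual l.shape)) := by
  have hleaf : ∀ t : AOTree, t.shape = .leaf ↔ ∃ v b, t = .leaf v b := by
    intro t
    cases t <;> simp [shape]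
  cases c
  all_goals
    simp only [IsSimpleXT, isSimpleTautology_iff, isSimpleContradiction_iff, node.injEq,
      reduceCtorEq, false_and, true_and, or_self, exists_false, or_false, false_or, hleaf,
      Conn.dual]
    constructor
    · rintro ⟨v, b, s, ⟨rfl, rfl⟩ | ⟨rfl, rfl⟩, h⟩
      · exact Or.inl ⟨⟨v, b, rfl⟩, h⟩
      · exact Or.inr ⟨⟨v, b, rfl⟩, h⟩
    · rintro (⟨⟨v, b, rfl⟩, h⟩ | ⟨⟨v, b, rfl⟩, h⟩)
      · exact ⟨v, b, r, Or.inl ⟨rfl, rfl⟩, h⟩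
      · exact ⟨v, b, l, Or.inr ⟨rfl, rfl⟩, h⟩

theorem hasConflict_map_left (c : Conn) (l r : AOTree) (J : Finset ℕ) :
    HasConflict (.node c l r) (J.map (addLeftEmbedding l.shape.size)) ↔ HasConflict r J := by
  simp only [HasConflict, Finset.mem_map, addLeftEmbedding_apply, exists_exists_and_eq_and,
    lv_node_add]

theorem hasConflict_node_of_lt (c : Conn) (l r : AOTree) {J : Finset ℕ}
    (hJ : ∀ i ∈ J, i < l.shape.size) : HasConflict (.node c l r) J ↔ HasConflict l J := by
  refine exists_congr fun i => and_congr_right fun hi => exists_congr fun j =>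
    and_congr_right fun hj => ?_
  rw [lv_node_of_lt _ _ _ (hJ i hi), lv_node_of_lt _ _ _ (hJ j hj)]

theorem isSimpleXT_iff (t : AOTree) :
    IsSimpleXT t ↔ HasConflict t (Shape.besideLeaf t.shape) := by
  rcases t with ⟨v, b⟩ | ⟨c, l, r⟩
  · simp [IsSimpleXT, shape, Shape.besideLeaf, HasConflict]
  rw [isSimpleXT_node]
  rcases l with ⟨v, b⟩ | ⟨d, l, l'⟩
  · have := hasConflict_map_left c (.leaf v b) r (Shape.linked c.dual r.shape)
    simp only [shape, Shape.size] at this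
    simp only [shape, Shape.besideLeaf, this, true_and, or_iff_left_iff_imp]
    exact fun h => (not_hasConflict_leaf _ _ _ h.2).elim
  · rcases r with ⟨v, b⟩ | ⟨d', r, r'⟩
    · simp only [shape, Shape.besideLeaf, reduceCtorEq, false_and, true_and, false_or]
      exact (hasConflict_node_of_lt _ _ _ fun i hi => Shape.lt_size_of_mem_linked hi).symm
    · simp [shape, Shape.besideLeaf, HasConflict]

theorem hasConflict_iff_opp {n : ℕ} (t : AOTree) {J : Finset ℕ} (hJ : ∀ i ∈ J, i < n) :
    HasConflict t J ↔
      ∃ i j : Fin n, (i : ℕ) ∈ J ∧ (j : ℕ) ∈ J ∧ (labelClass n t).Opp i j := by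
  simp only [labelClass, LabelClass.opp_of]
  constructor
  · rintro ⟨i, hi, j, hj, h⟩
    exact ⟨⟨i, hJ i hi⟩, ⟨j, hJ j hj⟩, hi, hj, h⟩
  · rintro ⟨i, j, hi, hj, h⟩
    exact ⟨i, hi, j, hj, h⟩

theorem tcount_eq (n K : ℕ) :
    Tcount (n + 1) K = (Shape.ofNodes n).card * LabelClass.count (n + 1) K := by
  rw [Tcount, classCount_eq_sum n (fun _ c => c.vars ≤ K), Finset.sum_const, smul_eq_mul]
  · rw [LabelClass.count]
    congr!
  · exact fun t => and_congr_right fun ht => by rw [vars_labelClass ht]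

theorem classCount_isSimpleXT (n K : ℕ) :
    (classCount fun t => t.size = n + 1 ∧ t.varCount ≤ K ∧ IsSimpleXT t) =
      ∑ s ∈ Shape.ofNodes n, (LabelClass.conflicts (n + 1) K s.besideLeaf).card := by
  rw [classCount_eq_sum n fun s c => c.vars ≤ K ∧
    ∃ i j : Fin (n + 1), (i : ℕ) ∈ s.besideLeaf ∧ (j : ℕ) ∈ s.besideLeaf ∧ c.Opp i j]
  · simp only [LabelClass.conflicts]
    congr!
  · refine fun t => and_congr_right fun ht => ?_
    rw [vars_labelClass ht, isSimpleXT_iff, hasConflict_iff_opp]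
    intro i hi
    rw [← ht, ← size_shape]
    exact Shape.lt_size_of_mem_besideLeaf hi

end AOTree

end Trees

section Stirling

theorem mul_stirling_le_succ (m : ℕ) : ∀ p, p * stirling m p ≤ stirling (m + 1) p
  | 0 => by simp
  | p + 1 => Nat.le_add_right _ _

theorem stirling_le_pow : ∀ m p, stirling m p ≤ (p + 1) ^ m
  | 0, 0 => le_rfl
  | 0, _ + 1 => Nat.zero_le _
  | _ + 1, 0 => Nat.zero_le _
  | m + 1, p + 1 =>
    calc (p + 1) * stirling m (p + 1) + stirling m p
        ≤ (p + 1) * (p + 1 + 1) ^ m + (p + 1 + 1) ^ m :=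
          add_le_add (Nat.mul_le_mul_left _ (stirling_le_pow m (p + 1)))
            ((stirling_le_pow m p).trans (Nat.pow_le_pow_left (Nat.le_succ _) m))
      _ = (p + 1 + 1) ^ (m + 1) := by ring

theorem one_le_stirling_self : ∀ p, 1 ≤ stirling p p
  | 0 => le_rfl
  | p + 1 => (one_le_stirling_self p).trans (Nat.le_add_left _ _)

theorem pow_le_stirling_add (p j : ℕ) : p ^ j ≤ stirling (p + j) p := by
  induction j with
  | zero => exact one_le_stirling_self p
  | succ j ih =>
    rw [pow_succ']
    exact (Nat.mul_le_mul_left p ih).trans (mul_stirling_le_succ _ _)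

theorem stirling_div_nonneg (m p : ℕ) : (0 : ℝ) ≤ (stirling m p : ℝ) / 2 ^ p := by positivity

theorem B_nonneg (m K : ℕ) : 0 ≤ B m K := Finset.sum_nonneg fun p _ => stirling_div_nonneg m p

theorem pow_div_le_B {L K : ℕ} (hL : 1 ≤ L) (hLK : L ≤ K) (j : ℕ) :
    (L : ℝ) ^ j / 2 ^ L ≤ B (L + j) K := by
  refine le_trans ?_ (Finset.single_le_sum (f := fun p => (stirling (L + j) p : ℝ) / 2 ^ p)
    (fun p _ => stirling_div_nonneg _ p) (Finset.mem_Icc.2 ⟨hL, hLK⟩))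
  gcongr
  exact_mod_cast pow_le_stirling_add L j

theorem B_pos {m K : ℕ} (hm : 1 ≤ m) (hK : 1 ≤ K) : 0 < B m K := by
  obtain ⟨j, rfl⟩ := Nat.exists_eq_add_of_le hm
  exact lt_of_lt_of_le (by positivity) (pow_div_le_B le_rfl hK j)

theorem B_le (m M : ℕ) : B m M ≤ M * ((M : ℝ) + 1) ^ m := by
  rw [B, ← nsmul_eq_mul]
  refine (Finset.sum_le_card_nsmul _ _ (((M : ℝ) + 1) ^ m) fun p hp => ?_).trans_eq (by simp)
  have hp' : p ≤ M := (Finset.mem_Icc.1 hp).2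
  calc (stirling m p : ℝ) / 2 ^ p ≤ stirling m p :=
        div_le_self (Nat.cast_nonneg _) (one_le_pow₀ one_le_two)
    _ ≤ ((p : ℝ) + 1) ^ m := by exact_mod_cast stirling_le_pow m p
    _ ≤ ((M : ℝ) + 1) ^ m := by gcongr

theorem mul_sub_le_B_succ (m : ℕ) {M K : ℕ} (hMK : M ≤ K) :
    ((M : ℝ) + 1) * (B m K - B m M) ≤ B (m + 1) K := by
  have hsub : Finset.Icc 1 M ⊆ Finset.Icc 1 K := Finset.Icc_subset_Icc_right hMK
  rw [B, B, B, ← Finset.sum_sdiff hsub, add_sub_cancel_right, Finset.mul_sum]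
  refine (Finset.sum_le_sum fun p hp => ?_).trans (Finset.sum_le_sum_of_subset_of_nonneg
    Finset.sdiff_subset fun p _ _ => stirling_div_nonneg (m + 1) p)
  have hp' : M + 1 ≤ p := by
    simp only [Finset.mem_sdiff, Finset.mem_Icc] at hp
    omega
  rw [← mul_div_assoc]
  gcongr
  calc ((M : ℝ) + 1) * stirling m p ≤ p * stirling m p := by
        gcongr
        exact_mod_cast hp'
    _ ≤ stirling (m + 1) p := by exact_mod_cast mul_stirling_le_succ m p

theorem eventually_two_mul_B_le (M : ℕ) {κ : ℕ → ℕ} (hκ : Tendsto κ atTop atTop) :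
    ∀ᶠ m in atTop, 2 * B m M ≤ B m (κ m) := by
  have hlt : (M : ℝ) + 1 < M + 2 := by linarith
  have hO := (isLittleO_pow_pow_of_lt_left (by positivity) hlt).def
    (c := (2 * M * (M + 1) ^ (M + 2) * 2 ^ (M + 2) + 1)⁻¹) (by positivity)
  have hshift : Tendsto (fun m : ℕ => m - (M + 2)) atTop atTop := tendsto_sub_atTop_nat _
  filter_upwards [hshift.eventually hO, hκ.eventually_ge_atTop (M + 2),
    eventually_ge_atTop (M + 2)] with m hm hκm hMm
  obtain ⟨j, rfl⟩ := Nat.exists_eq_add_of_le hMm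
  rw [Nat.add_sub_cancel_left, Real.norm_of_nonneg (by positivity),
    Real.norm_of_nonneg (by positivity), inv_mul_eq_div, le_div_iff₀ (by positivity)] at hm
  have h1 := B_le (M + 2 + j) M
  have h2 := pow_div_le_B (by omega) hκm j
  refine le_trans ?_ h2
  rw [le_div_iff₀ (by positivity)]
  push_cast
  have h3 : (0 : ℝ) ≤ ((M : ℝ) + 1) ^ j := by positivity
  calc 2 * B (M + 2 + j) M * 2 ^ (M + 2)
      ≤ 2 * (M * ((M : ℝ) + 1) ^ (M + 2 + j)) * 2 ^ (M + 2) := by gcongr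
    _ = (M + 1) ^ j * (2 * M * (M + 1) ^ (M + 2) * 2 ^ (M + 2)) := by rw [pow_add]; ring
    _ ≤ _ := by linarith

theorem tendsto_B_div_B_succ {κ : ℕ → ℕ} (hκ : Tendsto κ atTop atTop) :
    Tendsto (fun m => B m (κ m) / B (m + 1) (κ m)) atTop (nhds 0) := by
  refine tendsto_order.2 ⟨fun a ha => ?_, fun ε hε => ?_⟩
  · exact Eventually.of_forall fun m => ha.trans_le (div_nonneg (B_nonneg _ _) (B_nonneg _ _))
  obtain ⟨M, hM⟩ := exists_nat_gt (2 / ε)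
  filter_upwards [eventually_two_mul_B_le M hκ, hκ.eventually_ge_atTop (M + 1)] with m hm hκm
  have hpos : 0 < B (m + 1) (κ m) := B_pos (by omega) (by omega)
  have hle := mul_sub_le_B_succ m (M := M) (K := κ m) (by omega)
  have hnn := B_nonneg m (κ m)
  rw [div_lt_iff₀ hpos]
  rw [div_lt_iff₀ hε] at hM
  rcases hnn.eq_or_lt with h0 | h0
  · rw [← h0]
    positivity
  · nlinarith [mul_lt_mul_of_pos_right hM h0,
      mul_nonneg (Nat.cast_nonneg (α := ℝ) M) (sub_nonneg.2 hm)]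

end Stirling

section Asymptotics

theorem classCount_isSimpleXT_bounds (m K : ℕ) :
    ((classCount fun t => t.size = m + 5 ∧ t.varCount ≤ K ∧ IsSimpleXT t : ℕ) : ℝ) ≤
        (PowerSeries.coeff (m + 4) Shape.series - 2 * PowerSeries.coeff (m + 3) Shape.series) *
          LabelClass.count (m + 4) K ∧
      (PowerSeries.coeff (m + 4) Shape.series - 2 * PowerSeries.coeff (m + 3) Shape.series) *
          LabelClass.count (m + 4) K ≤
        ((classCount fun t => t.size = m + 5 ∧ t.varCount ≤ K ∧ IsSimpleXT t : ℕ) : ℝ) +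
          144 * PowerSeries.coeff (m + 4) Shape.series * LabelClass.count (m + 3) K := by
  have hsum2 : ∑ s ∈ Shape.ofNodes (m + 4), (s.besideLeaf.card.choose 2 : ℝ) =
      PowerSeries.coeff (m + 4) Shape.series - 2 * PowerSeries.coeff (m + 3) Shape.series := by
    rw [Shape.sum_choose_besideLeaf m 2 two_ne_zero, Shape.coeff_linkedSeries_two,
      Shape.coeff_linkedSeries_two]
    ring
  have hsum3 : ∑ s ∈ Shape.ofNodes (m + 4), (s.besideLeaf.card.choose 3 : ℝ) ≤
      4 * PowerSeries.coeff (m + 4) Shape.series := by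
    rw [Shape.sum_choose_besideLeaf m 3 three_ne_zero]
    linarith [Shape.coeff_linkedSeries_three_le .and m, Shape.coeff_linkedSeries_three_le .or m]
  have hsum4 : ∑ s ∈ Shape.ofNodes (m + 4), (s.besideLeaf.card.choose 4 : ℝ) ≤
      20 * PowerSeries.coeff (m + 4) Shape.series := by
    rw [Shape.sum_choose_besideLeaf m 4 four_ne_zero]
    linarith [Shape.coeff_linkedSeries_four_le .and m, Shape.coeff_linkedSeries_four_le .or m]
  have hbounds : ∀ s ∈ Shape.ofNodes (m + 4), _ := fun s hs =>
    LabelClass.conflicts_bounds (n := m + 3) K (J := s.besideLeaf) fun i hi =>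
      (Shape.lt_size_of_mem_besideLeaf hi).trans_eq (Shape.mem_ofNodes.1 hs)
  rw [AOTree.classCount_isSimpleXT (m + 4) K, ← hsum2]
  push_cast
  rw [Finset.sum_mul]
  constructor
  · exact Finset.sum_le_sum fun s hs => by exact_mod_cast (hbounds s hs).1
  · calc ∑ s ∈ Shape.ofNodes (m + 4),
          (s.besideLeaf.card.choose 2 : ℝ) * LabelClass.count (m + 4) K
        ≤ ∑ s ∈ Shape.ofNodes (m + 4),
            (((LabelClass.conflicts (m + 5) K s.besideLeaf).card : ℝ) +
              6 * ((s.besideLeaf.card.choose 3 : ℝ) + s.besideLeaf.card.choose 4) *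
                LabelClass.count (m + 3) K) :=
          Finset.sum_le_sum fun s hs => by exact_mod_cast (hbounds s hs).2
      _ = ∑ s ∈ Shape.ofNodes (m + 4),
            ((LabelClass.conflicts (m + 5) K s.besideLeaf).card : ℝ) +
          6 * (∑ s ∈ Shape.ofNodes (m + 4), (s.besideLeaf.card.choose 3 : ℝ) +
            ∑ s ∈ Shape.ofNodes (m + 4), (s.besideLeaf.card.choose 4 : ℝ)) *
              LabelClass.count (m + 3) K := by
          rw [Finset.sum_add_distrib, ← Finset.sum_mul, ← Finset.mul_sum, Finset.sum_add_distrib]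
      _ ≤ _ := add_le_add le_rfl
          (mul_le_mul_of_nonneg_right (by linarith) (Nat.cast_nonneg _))

theorem isSimpleXT_ratio_bounds (m : ℕ) {K : ℕ} (hK : 1 ≤ K) :
    1 / 2 - PowerSeries.coeff (m + 3) Shape.series / PowerSeries.coeff (m + 4) Shape.series -
          36 * (B (m + 3) K / B (m + 4) K) ≤
        ((classCount fun t => t.size = m + 5 ∧ t.varCount ≤ K ∧ IsSimpleXT t : ℕ) : ℝ) /
          Tcount (m + 5) K / (B (m + 4) K / B (m + 5) K) ∧
      ((classCount fun t => t.size = m + 5 ∧ t.varCount ≤ K ∧ IsSimpleXT t : ℕ) : ℝ) /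
          Tcount (m + 5) K / (B (m + 4) K / B (m + 5) K) ≤
        1 / 2 -
          PowerSeries.coeff (m + 3) Shape.series / PowerSeries.coeff (m + 4) Shape.series := by
  obtain ⟨hupper, hlower⟩ := classCount_isSimpleXT_bounds m K
  have hT : (Tcount (m + 5) K : ℝ) =
      PowerSeries.coeff (m + 4) Shape.series * (2 ^ (m + 5) * B (m + 5) K) := by
    rw [AOTree.tcount_eq (m + 4) K, Nat.cast_mul, LabelClass.count_eq, Shape.card_ofNodes,
      Shape.coeff_series]
  rw [LabelClass.count_eq] at hupper hlower
  rw [LabelClass.count_eq] at hlower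
  rw [hT]
  set x := ((classCount fun t => t.size = m + 5 ∧ t.varCount ≤ K ∧ IsSimpleXT t : ℕ) : ℝ)
  have hd := Shape.coeff_series_pos (m + 4)
  set d := PowerSeries.coeff (m + 4) Shape.series
  set e := PowerSeries.coeff (m + 3) Shape.series
  have h4 : 0 < B (m + 4) K := B_pos (by omega) hK
  have h5 : 0 < B (m + 5) K := B_pos (by omega) hK
  have hx : x / (d * (2 ^ (m + 5) * B (m + 5) K)) / (B (m + 4) K / B (m + 5) K) =
      x / (2 * d * (2 ^ (m + 4) * B (m + 4) K)) := by
    field_simp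
    ring
  rw [hx]
  constructor
  · rw [le_div_iff₀ (by positivity)]
    have : (1 / 2 - e / d - 36 * (B (m + 3) K / B (m + 4) K)) *
        (2 * d * (2 ^ (m + 4) * B (m + 4) K)) =
        (d - 2 * e) * (2 ^ (m + 3 + 1) * B (m + 3 + 1) K) -
          144 * d * (2 ^ (m + 2 + 1) * B (m + 2 + 1) K) := by
      field_simp
      ring
    rw [this]
    exact sub_le_iff_le_add.2 hlower
  · rw [div_le_iff₀ (by positivity)]
    refine hupper.trans_eq ?_
    field_simp

theorem tendsto_coeff_series_div_succ :
    Tendsto (fun m => PowerSeries.coeff m Shape.series / PowerSeries.coeff (m + 1) Shape.series)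
      atTop (nhds (1 / 8)) := by
  have hlim : Tendsto (fun m : ℕ => 1 / 8 + 3 / 2 * (1 / (8 * (m : ℝ) + 4))) atTop
      (nhds (1 / 8 + 3 / 2 * 0)) := by
    refine tendsto_const_nhds.add (tendsto_const_nhds.mul ?_)
    simp only [one_div]
    exact (tendsto_atTop_add_const_right _ _
      (tendsto_natCast_atTop_atTop.const_mul_atTop (by norm_num))).inv_tendsto_atTop
  rw [mul_zero, add_zero] at hlim
  refine hlim.congr fun m => ?_
  have h := Shape.coeff_series_succ_mul m
  have hpos := Shape.coeff_series_pos (m + 1)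
  have h8 : (8 * (m : ℝ) + 4) ≠ 0 := by positivity
  rw [eq_div_iff hpos.ne']
  field_simp
  linarith

end Asymptotics

/-- the ratio of simple-x trees of type T satisfies
`X^T_n/T_n ∼ (3/8)·rat_n`. -/
theorem stmt_14 (k : ℕ → ℕ) (hk_mono : Monotone k)
    (hk_pos : ∀ n, 1 ≤ n → 1 ≤ k n) (hk_le : ∀ n, 1 ≤ n → k n ≤ n)
    (hk_tend : Tendsto k atTop atTop) :
    Tendsto
      (fun n =>
        ((classCount fun t =>
            t.size = n ∧ t.varCount ≤ k n ∧ IsSimpleXT t : ℕ) : ℝ)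
          / (Tcount n (k n) : ℝ) / rat k n)
      atTop (nhds (3 / 8)) := by
  rw [← tendsto_add_atTop_iff_nat 5]
  have hcoeff := tendsto_coeff_series_div_succ.comp (tendsto_add_atTop_nat 3)
  have hB := (tendsto_B_div_B_succ (hk_tend.comp (tendsto_add_atTop_nat 2))).comp
    (tendsto_add_atTop_nat 3)
  have hupper := hcoeff.const_sub (1 / 2)
  have hlower := hupper.sub (hB.const_mul 36)
  rw [mul_zero, sub_zero] at hlower
  rw [show (1 / 2 - 1 / 8 : ℝ) = 3 / 8 by norm_num] at hupper hlower
  have hbounds := fun m => isSimpleXT_ratio_bounds m (hk_pos (m + 5) (by omega))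
  exact tendsto_of_tendsto_of_tendsto_of_le_of_le hlower hupper (fun m => (hbounds m).1)
    fun m => (hbounds m).2

end CatalanSat
end

section
/- Fix an increasing sequence (k_n)_{n≥1} of positive integers with k_n ≤ n for all n and k_n → ∞, and set rat_n = B_{n−1,k_n}/B_{n,k_n}. Let X^X_n be the number of equivalence classes of simple-x trees of type X of size n using at most k_n distinct variables and T_n the number of equivalence classes of all and/or trees of size n using at most k_n distinct variables. Then, asymptotically as n → ∞, X^X_n/T_n ∼ (1/4)·rat_n. -/
open Filter

namespace CatalanSat

instance : DecidableEq Conn := fun a b => by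
  cases a <;> cases b <;> first | exact isTrue rfl | exact isFalse (by simp)

instance : Fintype Conn := ⟨{.and, .or}, fun c => by cases c <;> simp⟩

theorem Conn.card : Fintype.card Conn = 2 := rfl

noncomputable instance : DecidableEq Shape := Classical.decEq _

noncomputable instance : DecidableEq AOTree := Classical.decEq _

/-- The other connective. -/
def Conn.flip : Conn → Conn
  | .and => .or
  | .or => .and

theorem Conn.flip_injective : Function.Injective Conn.flip := by
  intro a b h
  cases a <;> cases b <;> simp_all [Conn.flip]

/-! ### Tree equivalence -/

theorem TreeEquiv.refl (A : AOTree) : TreeEquiv A A := ⟨rfl, fun _ _ _ _ => ⟨Iff.rfl, Iff.rfl⟩⟩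

theorem AOTree.length_leaves (t : AOTree) : t.leaves.length = t.shape.size := by
  induction t with
  | leaf v b => rfl
  | node c l r hl hr => simp [AOTree.leaves, AOTree.shape, Shape.size, hl, hr]

theorem TreeEquiv.length_eq {A B : AOTree} (h : TreeEquiv A B) :
    A.leaves.length = B.leaves.length := by
  rw [A.length_leaves, B.length_leaves, h.1]

theorem TreeEquiv.symm {A B : AOTree} (h : TreeEquiv A B) : TreeEquiv B A :=
  ⟨h.1.symm, fun i j hi hj =>
    have := h.2 i j (h.length_eq ▸ hi) (h.length_eq ▸ hj)
    ⟨this.1.symm, this.2.symm⟩⟩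

theorem TreeEquiv.trans {A B C : AOTree} (h : TreeEquiv A B) (h' : TreeEquiv B C) :
    TreeEquiv A C :=
  ⟨h.1.trans h'.1, fun i j hi hj =>
    have h₁ := h.2 i j hi hj
    have h₂ := h'.2 i j (h.length_eq ▸ hi) (h.length_eq ▸ hj)
    ⟨h₁.1.trans h₂.1, h₁.2.trans h₂.2⟩⟩

/-- Counting equivalence classes with a complete system of representatives. -/
theorem classCount_eq_card {P : AOTree → Prop} (R : Finset AOTree) (hP : ∀ t ∈ R, P t)
    (hex : ∀ t, P t → ∃ r ∈ R, TreeEquiv t r)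
    (huniq : ∀ r ∈ R, ∀ r' ∈ R, TreeEquiv r r' → r = r') : classCount P = R.card := by
  let S : Setoid {t : AOTree // P t} :=
    ⟨fun A B => TreeEquiv A.1 B.1, ⟨fun A => TreeEquiv.refl A.1, TreeEquiv.symm, TreeEquiv.trans⟩⟩
  rw [classCount, ← Nat.card_eq_finsetCard R]
  symm
  refine Nat.card_congr (Equiv.ofBijective
    (fun r : R => (Quotient.mk S ⟨r.1, hP r.1 r.2⟩ : Quotient S)) ⟨?_, ?_⟩)
  · intro r r' h
    exact Subtype.ext (huniq _ r.2 _ r'.2 (Quotient.exact h))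
  · intro q
    induction q using Quotient.inductionOn with
    | h t =>
      obtain ⟨r, hr, htr⟩ := hex t.1 t.2
      exact ⟨⟨r, hr⟩, Quotient.sound (s := S) htr.symm⟩

/-- The equivalence of leaf labellings underlying `TreeEquiv`. -/
def WordEquiv (w w' : List (ℕ × Bool)) : Prop :=
  ∀ p ∈ w.zip w', ∀ q ∈ w.zip w', (p.1.1 = q.1.1 ↔ p.2.1 = q.2.1) ∧ (p.1 = q.1 ↔ p.2 = q.2)

theorem mem_zip_self {α : Type*} {x : α} {w : List α} (h : x ∈ w) : (x, x) ∈ w.zip w := by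
  induction w with
  | nil => simp at h
  | cons y w ih => rcases List.mem_cons.1 h with rfl | h <;> simp_all

theorem WordEquiv.mono {w w' u u' : List (ℕ × Bool)} (h : WordEquiv w w')
    (hsub : u.zip u' ⊆ w.zip w') : WordEquiv u u' :=
  fun p hp q hq => h p (hsub hp) q (hsub hq)

theorem TreeEquiv.wordEquiv {A B : AOTree} (h : TreeEquiv A B) : WordEquiv A.leaves B.leaves := by
  intro p hp q hq
  obtain ⟨i, hi, rfl⟩ := List.mem_iff_getElem.1 hp
  obtain ⟨j, hj, rfl⟩ := List.mem_iff_getElem.1 hq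
  have hlen := h.length_eq
  simp only [List.length_zip, lt_min_iff] at hi hj
  have := h.2 i j hi.1 hj.1
  simpa [lv, hi.1, hi.2, hj.1, hj.2] using this

/-! ### Relabelling -/

/-- The action on literals of a permutation of the variables and a change of polarities. -/
def relabel (σ : Equiv.Perm ℕ) (ε : ℕ → Bool) (x : ℕ × Bool) : ℕ × Bool :=
  (σ x.1, xor (ε x.1) x.2)

theorem relabel_injective (σ : Equiv.Perm ℕ) (ε : ℕ → Bool) :
    Function.Injective (relabel σ ε) := by
  rintro ⟨v, b⟩ ⟨v', b'⟩ h
  simp only [relabel, Prod.mk.injEq, EmbeddingLike.apply_eq_iff_eq] at h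
  obtain ⟨rfl, h⟩ := h
  simpa using h

/-- Apply a function to all leaf labels. -/
def AOTree.map (f : ℕ × Bool → ℕ × Bool) : AOTree → AOTree
  | .leaf v b => .leaf (f (v, b)).1 (f (v, b)).2
  | .node c l r => .node c (l.map f) (r.map f)

theorem AOTree.leaves_map (f : ℕ × Bool → ℕ × Bool) (t : AOTree) :
    (t.map f).leaves = t.leaves.map f := by
  induction t with
  | leaf v b => rfl
  | node c l r hl hr => simp [AOTree.map, AOTree.leaves, hl, hr]

theorem AOTree.shape_map (f : ℕ × Bool → ℕ × Bool) (t : AOTree) : (t.map f).shape = t.shape := by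
  induction t with
  | leaf v b => rfl
  | node c l r hl hr => simp [AOTree.map, AOTree.shape, hl, hr]

theorem treeEquiv_map_relabel (σ : Equiv.Perm ℕ) (ε : ℕ → Bool) (t : AOTree) :
    TreeEquiv t (t.map (relabel σ ε)) := by
  refine ⟨(t.shape_map _).symm, fun i j hi hj => ?_⟩
  simp only [lv, AOTree.leaves_map]
  simp only [List.getD_eq_getElem?_getD, List.getElem?_map, List.getElem?_eq_getElem hi,
    List.getElem?_eq_getElem hj, Option.map_some, Option.getD_some,
    (relabel_injective σ ε).eq_iff]
  simp [relabel]

/-- The number of distinct variables of a word. -/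
def varNum (w : List (ℕ × Bool)) : ℕ := (w.map Prod.fst).toFinset.card

theorem varNum_map_relabel (σ : Equiv.Perm ℕ) (ε : ℕ → Bool) (w : List (ℕ × Bool)) :
    varNum (w.map (relabel σ ε)) = varNum w := by
  have : ((w.map (relabel σ ε)).map Prod.fst).toFinset = (w.map Prod.fst).toFinset.image σ := by
    ext; simp [relabel]
  rw [varNum, this, Finset.card_image_of_injective _ σ.injective, varNum]

theorem varNum_cons_of_mem {x : ℕ × Bool} {w : List (ℕ × Bool)} (h : x.1 ∈ w.map Prod.fst) :
    varNum (x :: w) = varNum w := by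
  rw [varNum, List.map_cons, List.toFinset_cons, Finset.insert_eq_of_mem (by simpa using h), varNum]

theorem varNum_cons_of_notMem {x : ℕ × Bool} {w : List (ℕ × Bool)} (h : x.1 ∉ w.map Prod.fst) :
    varNum (x :: w) = varNum w + 1 := by
  rw [varNum, List.map_cons, List.toFinset_cons,
    Finset.card_insert_of_notMem (by simpa using h), varNum]

/-! ### Canonical words -/

/-- A word is canonical if, read from right to left, its variables are introduced in increasing
order, each one first with positive polarity. -/
def Canon : List (ℕ × Bool) → Prop
  | [] => True
  | x :: w => Canon w ∧ (x.1 < varNum w ∨ x = (varNum w, true))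

theorem Canon.mem_iff {w : List (ℕ × Bool)} (h : Canon w) (v : ℕ) :
    v ∈ w.map Prod.fst ↔ v < varNum w := by
  induction w generalizing v with
  | nil => simp [varNum]
  | cons x w ih =>
    obtain ⟨hw, hx⟩ := h
    replace ih := ih hw
    rcases hx with hx | rfl
    · rw [varNum_cons_of_mem ((ih _).2 hx), List.map_cons, List.mem_cons, ih v]
      constructor
      · rintro (rfl | h) <;> assumption
      · exact Or.inr
    · rw [varNum_cons_of_notMem (fun h => lt_irrefl _ ((ih _).1 h)),
        List.map_cons, List.mem_cons, ih v]
      simp only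
      omega

theorem exists_canon_relabel (w : List (ℕ × Bool)) :
    ∃ σ ε, Canon (w.map (relabel σ ε)) := by
  induction w with
  | nil => exact ⟨1, fun _ => false, trivial⟩
  | cons x w ih =>
    obtain ⟨σ, ε, h⟩ := ih
    by_cases hx : x.1 ∈ w.map Prod.fst
    · refine ⟨σ, ε, h, Or.inl ?_⟩
      rw [← h.mem_iff]
      simp only [List.mem_map] at hx ⊢
      obtain ⟨y, hy, hyx⟩ := hx
      exact ⟨relabel σ ε y, ⟨y, hy, rfl⟩, by simp [relabel, hyx]⟩
    · set p := varNum (w.map (relabel σ ε)) with hp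
      have hσx : σ x.1 ∉ (w.map (relabel σ ε)).map Prod.fst := by
        simp only [List.mem_map, not_exists, not_and] at hx ⊢
        rintro _ ⟨y, hy, rfl⟩ hyx
        exact hx y hy (σ.injective hyx)
      have hmap : w.map (relabel (σ.trans (Equiv.swap (σ x.1) p)) (Function.update ε x.1 (!x.2)))
          = w.map (relabel σ ε) := by
        refine List.map_congr_left fun y hy => ?_
        have hyx : y.1 ≠ x.1 := fun e => hx (e ▸ List.mem_map_of_mem hy)
        have hyp : σ y.1 < p :=
          (h.mem_iff _).1 (List.mem_map_of_mem (f := Prod.fst)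
            (List.mem_map_of_mem (f := relabel σ ε) hy))
        simp only [relabel, Equiv.trans_apply, Function.update_of_ne hyx]
        rw [Equiv.swap_apply_of_ne_of_ne (fun e => hyx (σ.injective e)) hyp.ne]
      refine ⟨σ.trans (Equiv.swap (σ x.1) p), Function.update ε x.1 (!x.2), ?_⟩
      rw [List.map_cons, hmap]
      exact ⟨h, Or.inr (by simp [relabel, hp])⟩

theorem WordEquiv.eq_of_canon {w w' : List (ℕ × Bool)} (hlen : w.length = w'.length)
    (he : WordEquiv w w') (hw : Canon w) (hw' : Canon w') : w = w' := by
  induction w generalizing w' with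
  | nil => exact (List.length_eq_zero_iff.1 hlen.symm).symm
  | cons x w ih =>
    obtain _ | ⟨y, w'⟩ := w'
    · simp at hlen
    obtain rfl : w = w' := ih (by simpa using hlen)
      (he.mono (by simp)) hw.1 hw'.1
    have key : ∀ z ∈ w, (x.1 = z.1 ↔ y.1 = z.1) ∧ (x = z ↔ y = z) := fun z hz =>
      he (x, y) (by simp) (z, z) (List.mem_cons_of_mem _ (mem_zip_self hz))
    have hv : x.1 < varNum w ↔ y.1 < varNum w := by
      simp only [← hw.1.mem_iff, List.mem_map]
      exact ⟨fun ⟨z, hz, e⟩ => ⟨z, hz, ((key z hz).1.1 e.symm).symm⟩,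
        fun ⟨z, hz, e⟩ => ⟨z, hz, ((key z hz).1.2 e.symm).symm⟩⟩
    congr 1
    by_cases hx : x.1 < varNum w
    · obtain ⟨z, hz, hzx⟩ := List.mem_map.1 ((hw.1.mem_iff _).2 hx)
      obtain ⟨h₁, h₂⟩ := key z hz
      have h₃ := h₁.1 hzx.symm
      obtain ⟨x₁, x₂⟩ := x
      obtain ⟨y₁, y₂⟩ := y
      obtain ⟨z₁, z₂⟩ := z
      simp only [Prod.mk.injEq] at *
      subst hzx h₃
      cases x₂ <;> cases y₂ <;> cases z₂ <;> simp_all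
    · rw [hw.2.resolve_left hx, hw'.2.resolve_left (hv.not.1 hx)]

/-- The canonical words of length `m` with exactly `p` variables. -/
def words : ℕ → ℕ → Finset (List (ℕ × Bool))
  | 0, 0 => {[]}
  | 0, _ + 1 => ∅
  | _ + 1, 0 => ∅
  | m + 1, p + 1 =>
    ((Finset.range (p + 1) ×ˢ Finset.univ) ×ˢ words m (p + 1)).image (fun q => q.1 :: q.2) ∪
      (words m p).image (fun w => (p, true) :: w)

theorem mem_words {m p : ℕ} {w : List (ℕ × Bool)} :
    w ∈ words m p ↔ w.length = m ∧ Canon w ∧ varNum w = p := by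
  induction m generalizing p w with
  | zero =>
    cases p with
    | zero => simp only [words, Finset.mem_singleton, List.length_eq_zero_iff]
              exact ⟨fun h => ⟨h, h ▸ trivial, h ▸ rfl⟩, fun h => h.1⟩
    | succ p =>
      simp only [words, Finset.notMem_empty, List.length_eq_zero_iff, false_iff]
      rintro ⟨rfl, -, h⟩
      simp [varNum] at h
  | succ m ih =>
    cases w with
    | nil => cases p <;> simp [words]
    | cons x w =>
      have hmem : Canon w → (x.1 < varNum w ↔ x.1 ∈ w.map Prod.fst) := fun h => (h.mem_iff _).symm
      cases p with
      | zero =>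
        simp [words, varNum]
      | succ p =>
        simp only [words, Finset.mem_union, Finset.mem_image, Finset.mem_product, Finset.mem_range,
          Finset.mem_univ, and_true, Prod.exists, List.cons.injEq, List.length_cons, ih, Canon]
        constructor
        · rintro (⟨a, b, w', ⟨h, hl, hc, hp⟩, rfl, rfl⟩ | ⟨w', ⟨hl, hc, hp⟩, rfl, rfl⟩)
          · have h' : a < varNum w' := by omega
            exact ⟨by omega, ⟨hc, Or.inl h'⟩, by rw [varNum_cons_of_mem ((hmem hc).1 h'), hp]⟩
          · exact ⟨by omega, ⟨hc, Or.inr (by rw [hp])⟩, by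
              rw [varNum_cons_of_notMem (fun h => by have := (hmem hc).2 h; simp [hp] at this), hp]⟩
        · rintro ⟨hl, ⟨hc, hx⟩, hp⟩
          rcases hx with hx | hx
          · rw [varNum_cons_of_mem ((hmem hc).1 hx)] at hp
            exact Or.inl ⟨x.1, x.2, w, ⟨by omega, by omega, hc, hp⟩, rfl, rfl⟩
          · rw [varNum_cons_of_notMem (fun h => by have := (hmem hc).2 h; simp [hx] at this)] at hp
            refine Or.inr ⟨w, ⟨by omega, hc, by omega⟩, ?_, rfl⟩
            rw [hx]; congr; omega

theorem card_words (m p : ℕ) : (words m p).card * 2 ^ p = 2 ^ m * stirling m p := by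
  induction m generalizing p with
  | zero => cases p <;> simp [words, stirling]
  | succ m ih =>
    cases p with
    | zero => simp [words, stirling]
    | succ p =>
      rw [words, Finset.card_union_of_disjoint, Finset.card_image_of_injOn,
        Finset.card_image_of_injOn, Finset.card_product, Finset.card_product]
      · have h₁ := ih p
        have h₂ := ih (p + 1)
        simp only [Finset.card_range, Finset.card_univ, Fintype.card_bool, stirling]
        calc _ = (p + 1) * 2 * ((words m (p + 1)).card * 2 ^ (p + 1))
              + 2 * ((words m p).card * 2 ^ p) := by ring
          _ = _ := by rw [h₁, h₂]; ring
      · intro a _ b _ h; simpa using h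
      · intro a _ b _ h; simpa [Prod.ext_iff] using h
      · rw [Finset.disjoint_left]
        simp only [Finset.mem_image, Finset.mem_product, Finset.mem_range, Prod.exists, mem_words]
        rintro _ ⟨x, b, w, ⟨-, -, -, h⟩, rfl⟩ ⟨w', ⟨-, -, h'⟩, e⟩
        simp only [List.cons.injEq] at e
        rw [← e.2, h'] at h
        omega

/-- The canonical words of length `m` with between `1` and `K` variables. -/
def wordsLE (m K : ℕ) : Finset (List (ℕ × Bool)) := (Finset.Icc 1 K).biUnion (words m)

theorem mem_wordsLE {m K : ℕ} (hm : 1 ≤ m) {w : List (ℕ × Bool)} :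
    w ∈ wordsLE m K ↔ w.length = m ∧ Canon w ∧ varNum w ≤ K := by
  simp only [wordsLE, Finset.mem_biUnion, Finset.mem_Icc, mem_words]
  constructor
  · rintro ⟨p, hp, hl, hc, rfl⟩
    exact ⟨hl, hc, hp.2⟩
  · rintro ⟨hl, hc, hK⟩
    refine ⟨_, ⟨?_, hK⟩, hl, hc, rfl⟩
    obtain _ | ⟨x, w⟩ := w
    · simp at hl; omega
    · exact Finset.card_pos.2 ⟨x.1, by simp⟩

theorem card_wordsLE (m K : ℕ) : ((wordsLE m K).card : ℝ) = 2 ^ m * B m K := by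
  rw [wordsLE, Finset.card_biUnion, B, Finset.mul_sum, Nat.cast_sum]
  · refine Finset.sum_congr rfl fun p _ => ?_
    rw [← mul_div_assoc, eq_div_iff (by positivity)]
    exact_mod_cast card_words m p
  · intro p _ q _ hpq
    rw [Function.onFun, Finset.disjoint_left]
    intro w hp hq
    exact hpq ((mem_words.1 hp).2.2.symm.trans (mem_words.1 hq).2.2)

theorem varNum_congr {w w' : List (ℕ × Bool)} (h : w.toFinset = w'.toFinset) :
    varNum w = varNum w' := by
  have key (u : List (ℕ × Bool)) : (u.map Prod.fst).toFinset = u.toFinset.image Prod.fst := by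
    ext; simp
  rw [varNum, varNum, key, key, h]

theorem Canon.eraseIdx {w : List (ℕ × Bool)} (hw : Canon w) {i j : ℕ} (hij : i < j)
    (hj : j < w.length) (h : w[i]? = w[j]?) :
    Canon (w.eraseIdx i) ∧ (w.eraseIdx i).toFinset = w.toFinset := by
  induction w generalizing i j with
  | nil => simp at hj
  | cons x w ih =>
    obtain _ | j := j
    · omega
    obtain _ | i := i
    · simp only [List.getElem?_cons_zero, List.getElem?_cons_succ] at h
      have hx : x ∈ w := List.mem_of_getElem? h.symm
      refine ⟨hw.1, ?_⟩
      rw [List.eraseIdx_zero, List.tail_cons, List.toFinset_cons,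
        Finset.insert_eq_of_mem (by simpa using hx)]
    · simp only [List.getElem?_cons_succ, List.length_cons] at h hj
      obtain ⟨h₁, h₂⟩ := ih hw.1 (by omega) (by omega) h
      rw [List.eraseIdx_cons_succ, List.toFinset_cons, List.toFinset_cons, h₂]
      refine ⟨⟨h₁, ?_⟩, rfl⟩
      rw [varNum_congr h₂]
      exact hw.2

/-- Merging two positions with equal labels yields a shorter canonical word. -/
theorem card_filter_wordsLE_le {m K i j : ℕ} (hm : 1 ≤ m) (hij : i < j) (hj : j < m + 1) :
    ((wordsLE (m + 1) K).filter fun w => w.getD i (0, true) = w.getD j (0, true)).card ≤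
      (wordsLE m K).card := by
  have key : ∀ w ∈ (wordsLE (m + 1) K).filter
      (fun w => w.getD i (0, true) = w.getD j (0, true)),
      w.length = m + 1 ∧ Canon w ∧ varNum w ≤ K ∧ w[i]? = w[j]? := by
    intro w hw
    rw [Finset.mem_filter, mem_wordsLE (by omega)] at hw
    obtain ⟨⟨hl, hc, hK⟩, h⟩ := hw
    have hi' : i < w.length := by omega
    have hj' : j < w.length := by omega
    simp only [List.getD_eq_getElem?_getD, List.getElem?_eq_getElem hi',
      List.getElem?_eq_getElem hj', Option.getD_some] at h
    exact ⟨hl, hc, hK, by rw [List.getElem?_eq_getElem hi', List.getElem?_eq_getElem hj', h]⟩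
  refine Finset.card_le_card_of_injOn (fun w => w.eraseIdx i) (fun w hw => ?_)
    (fun w hw w' hw' h => ?_)
  · obtain ⟨hl, hc, hK, h⟩ := key w hw
    obtain ⟨h₁, h₂⟩ := hc.eraseIdx hij (by omega) h
    rw [Finset.mem_coe, mem_wordsLE hm]
    refine ⟨?_, h₁, by rwa [varNum_congr h₂]⟩
    rw [List.length_eraseIdx_of_lt (by omega)]
    omega
  · obtain ⟨hl, -, -, e⟩ := key w hw
    obtain ⟨hl', -, -, e'⟩ := key w' hw'
    have hget (u : List (ℕ × Bool)) : (u.eraseIdx i)[j - 1]? = u[j]? := by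
      rw [List.getElem?_eraseIdx, if_neg (by omega), Nat.sub_add_cancel (by omega)]
    have hi : i < w.length := by omega
    have hi' : i < w'.length := by omega
    dsimp only at h
    have : w[i]? = w'[i]? := by rw [e, e', ← hget, ← hget, h]
    rw [List.getElem?_eq_getElem hi, List.getElem?_eq_getElem hi', Option.some_inj] at this
    rw [← List.insertIdx_eraseIdx_getElem hi, ← List.insertIdx_eraseIdx_getElem hi', h, this]

/-! ### Shapes -/

/-- The shapes with `N` internal nodes. -/
noncomputable def shapes : ℕ → Finset Shape
  | 0 => {.leaf}
  | N + 1 => (Finset.HasAntidiagonal.antidiagonal N).attach.biUnion fun ij =>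
    have := Finset.HasAntidiagonal.mem_antidiagonal.1 ij.2
    (Finset.univ ×ˢ shapes ij.1.1 ×ˢ shapes ij.1.2).image fun q => .node q.1 q.2.1 q.2.2
  decreasing_by all_goals omega

theorem shapes_succ (N : ℕ) : shapes (N + 1) =
    (Finset.HasAntidiagonal.antidiagonal N).biUnion fun ij =>
    (Finset.univ ×ˢ shapes ij.1 ×ˢ shapes ij.2).image fun q => .node q.1 q.2.1 q.2.2 := by
  rw [shapes]
  ext
  simp

theorem Shape.size_pos (s : Shape) : 1 ≤ s.size := by
  induction s with
  | leaf => exact le_rfl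
  | node c a b ha hb => simp only [Shape.size]; omega

theorem mem_shapes {N : ℕ} {s : Shape} : s ∈ shapes N ↔ s.size = N + 1 := by
  induction s generalizing N with
  | leaf =>
    cases N with
    | zero => simp [shapes, Shape.size]
    | succ N => simp [shapes_succ, Shape.size]
  | node c a b ha hb =>
    have := a.size_pos
    have := b.size_pos
    cases N with
    | zero =>
      simp only [shapes, Shape.size, Finset.mem_singleton, reduceCtorEq, false_iff]
      omega
    | succ N =>
      simp only [shapes_succ, Finset.mem_biUnion,
        Finset.HasAntidiagonal.mem_antidiagonal, Finset.mem_image,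
        Finset.mem_product, Finset.mem_univ, true_and, Prod.exists, Shape.node.injEq, Shape.size]
      constructor
      · rintro ⟨i, j, hij, _, _, _, ⟨h₁, h₂⟩, rfl, rfl, rfl⟩
        rw [ha] at h₁
        rw [hb] at h₂
        omega
      · intro h
        exact ⟨a.size - 1, b.size - 1, by omega, c, a, b, ⟨ha.2 (by omega), hb.2 (by omega)⟩,
          rfl, rfl, rfl⟩

theorem sum_shapes_succ {M : Type*} [AddCommMonoid M] (N : ℕ) (f : Shape → M) :
    ∑ s ∈ shapes (N + 1), f s = ∑ ij ∈ Finset.HasAntidiagonal.antidiagonal N, ∑ c : Conn,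
      ∑ a ∈ shapes ij.1, ∑ b ∈ shapes ij.2, f (.node c a b) := by
  rw [shapes_succ, Finset.sum_biUnion]
  · refine Finset.sum_congr rfl fun ij _ => ?_
    rw [Finset.sum_image, Finset.sum_product]
    · exact Finset.sum_congr rfl fun c _ => Finset.sum_product _ _ _
    · rintro ⟨c, a, b⟩ _ ⟨c', a', b'⟩ _ h
      simpa using h
  · intro ij _ ij' _ hne
    rw [Function.onFun, Finset.disjoint_left]
    simp only [Finset.mem_image, Finset.mem_product, Prod.exists, mem_shapes]
    rintro _ ⟨c, a, b, ⟨-, h₁, h₂⟩, rfl⟩ ⟨c', a', b', ⟨-, h₃, h₄⟩, h⟩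
    simp only [Shape.node.injEq] at h
    obtain ⟨rfl, rfl, rfl⟩ := h
    exact hne (Prod.ext (by omega) (by omega))

theorem card_shapes_succ (N : ℕ) : (shapes (N + 1)).card =
    2 * ∑ ij ∈ Finset.HasAntidiagonal.antidiagonal N, (shapes ij.1).card * (shapes ij.2).card := by
  rw [Finset.card_eq_sum_ones, sum_shapes_succ, Finset.mul_sum]
  simp [Conn.card, Finset.card_univ]

theorem card_shapes_zero : (shapes 0).card = 1 := by simp [shapes]

theorem card_shapes (N : ℕ) : (shapes N).card = 2 ^ N * catalan N := by
  induction N using Nat.strong_induction_on with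
  | _ N ih =>
    cases N with
    | zero => simp [shapes]
    | succ N =>
      rw [card_shapes_succ, catalan_succ', Finset.mul_sum, Finset.mul_sum]
      refine Finset.sum_congr rfl fun ij hij => ?_
      rw [Finset.HasAntidiagonal.mem_antidiagonal] at hij
      rw [ih _ (by omega), ih _ (by omega), ← hij]
      ring

theorem catalan_succ_mul (N : ℕ) : (N + 2) * catalan (N + 1) = 2 * (2 * N + 1) * catalan N := by
  have h₁ := succ_mul_catalan_eq_centralBinom N
  have h₂ := succ_mul_catalan_eq_centralBinom (N + 1)
  have h₃ := Nat.succ_mul_centralBinom_succ N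
  rw [← h₁, ← h₂] at h₃
  have : (N + 1) * ((N + 2) * catalan (N + 1)) = (N + 1) * (2 * (2 * N + 1) * catalan N) := by
    linarith
  exact Nat.eq_of_mul_eq_mul_left (by omega) this

theorem card_shapes_pos (N : ℕ) : 0 < (shapes N).card := by
  rw [card_shapes]
  have h : 0 < (N + 1) * catalan N := by
    rw [succ_mul_catalan_eq_centralBinom]
    exact Nat.centralBinom_pos N
  have := Nat.pos_of_mul_pos_left h
  positivity

theorem tendsto_card_shapes_div : Tendsto
    (fun N => ((shapes N).card : ℝ) / (shapes (N + 1)).card) atTop (nhds (1 / 8)) := by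
  have h : ∀ N : ℕ, ((shapes N).card : ℝ) / (shapes (N + 1)).card =
      1 / 8 + 3 / 8 * (1 / (2 * (N : ℝ) + 1)) := by
    intro N
    have h₀ : ((shapes (N + 1)).card : ℝ) ≠ 0 := by exact_mod_cast (card_shapes_pos (N + 1)).ne'
    have h₁ : ((N : ℝ) + 2) * (shapes (N + 1)).card = 4 * (2 * N + 1) * (shapes N).card := by
      have := catalan_succ_mul N
      rw [card_shapes, card_shapes]
      have h' : ((N : ℝ) + 2) * catalan (N + 1) = 2 * (2 * N + 1) * catalan N := by
        exact_mod_cast this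
      push_cast
      rw [pow_succ]
      linear_combination 2 ^ N * 2 * h'
    field_simp
    linear_combination -2 * h₁
  rw [funext h]
  have : Tendsto (fun N : ℕ => 1 / (2 * (N : ℝ) + 1)) atTop (nhds 0) := by
    refine tendsto_const_nhds.div_atTop ?_
    exact tendsto_atTop_add_const_right _ _
      (tendsto_natCast_atTop_atTop.const_mul_atTop two_pos)
  have h' := (this.const_mul (3 / 8)).const_add (1 / 8)
  rwa [mul_zero, add_zero] at h'

/-- The positions of the leaves linked to the root by nodes labelled `c` only. -/
def Shape.marks (c : Conn) : Shape → Finset ℕ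
  | .leaf => {0}
  | .node c' a b => if c' = c then a.marks c ∪ (b.marks c).image (a.size + ·) else ∅

theorem Shape.lt_size_of_mem_marks {c : Conn} {s : Shape} {i : ℕ} (h : i ∈ s.marks c) :
    i < s.size := by
  induction s generalizing i with
  | leaf => simp_all [Shape.marks, Shape.size]
  | node c' a b ha hb =>
    simp only [Shape.marks] at h
    split_ifs at h
    · rw [Finset.mem_union, Finset.mem_image] at h
      simp only [Shape.size]
      rcases h with h | ⟨j, h, rfl⟩
      · have := ha h
        omega
      · have := hb h
        omega
    · simp at h

theorem Shape.card_marks_node (c c' : Conn) (a b : Shape) : ((Shape.node c' a b).marks c).card =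
    if c' = c then (a.marks c).card + (b.marks c).card else 0 := by
  simp only [Shape.marks]
  split_ifs with h
  · rw [Finset.card_union_of_disjoint,
      Finset.card_image_of_injective _ (add_right_injective a.size)]
    rw [Finset.disjoint_left]
    intro i hi hi'
    obtain ⟨j, -, rfl⟩ := Finset.mem_image.1 hi'
    have := Shape.lt_size_of_mem_marks hi
    omega
  · rfl

theorem sum_card_marks (c : Conn) (N : ℕ) :
    ∑ s ∈ shapes N, (s.marks c).card = (shapes N).card := by
  induction N using Nat.strong_induction_on with
  | _ N ih =>
    cases N with
    | zero => simp [shapes, Shape.marks]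
    | succ N =>
      rw [sum_shapes_succ, card_shapes_succ, Finset.mul_sum]
      refine Finset.sum_congr rfl fun ij hij => ?_
      rw [Finset.HasAntidiagonal.mem_antidiagonal] at hij
      simp only [Shape.card_marks_node]
      rw [Finset.sum_eq_single c (by simp +contextual) (by simp)]
      simp only [if_true, Finset.sum_add_distrib, Finset.sum_const, smul_eq_mul, ← Finset.mul_sum]
      rw [ih _ (by omega), ih _ (by omega)]
      ring

theorem sum_card_marks_sq (c : Conn) (N : ℕ) :
    2 * ∑ s ∈ shapes N, (s.marks c).card ^ 2 = (shapes (N + 1)).card := by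
  induction N using Nat.strong_induction_on with
  | _ N ih =>
    cases N with
    | zero => rw [card_shapes_succ]; simp [shapes, Shape.marks]
    | succ N =>
      have hnode : ∀ ij ∈ Finset.HasAntidiagonal.antidiagonal N, (∑ c' : Conn, ∑ a ∈ shapes ij.1,
          ∑ b ∈ shapes ij.2, 2 * ((Shape.node c' a b).marks c).card ^ 2) =
          (shapes (ij.1 + 1)).card * (shapes ij.2).card +
            (shapes ij.1).card * (shapes (ij.2 + 1)).card +
            4 * ((shapes ij.1).card * (shapes ij.2).card) := by
        intro ij hij
        rw [Finset.HasAntidiagonal.mem_antidiagonal] at hij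
        simp only [Shape.card_marks_node]
        rw [Finset.sum_eq_single c (by simp +contextual) (by simp)]
        rw [← ih ij.1 (by omega), ← ih ij.2 (by omega)]
        have := sum_card_marks c ij.1
        have := sum_card_marks c ij.2
        simp only [if_true, add_sq, mul_add, Finset.sum_add_distrib, Finset.sum_const, smul_eq_mul,
          ← Finset.mul_sum, ← Finset.sum_mul, mul_assoc]
        simp only [*]
        ring
      rw [Finset.mul_sum, sum_shapes_succ, Finset.sum_congr rfl hnode, card_shapes_succ (N + 1),
        Finset.Nat.antidiagonal_succ, Finset.sum_cons, Finset.sum_map, Finset.sum_add_distrib,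
        Finset.sum_add_distrib, ← Finset.mul_sum]
      have hsymm : ∑ ij ∈ Finset.HasAntidiagonal.antidiagonal N,
            (shapes ij.1).card * (shapes (ij.2 + 1)).card =
          ∑ ij ∈ Finset.HasAntidiagonal.antidiagonal N,
            (shapes (ij.1 + 1)).card * (shapes ij.2).card := by
        rw [← Finset.Nat.sum_antidiagonal_swap]
        exact Finset.sum_congr rfl fun ij _ => mul_comm _ _
      have := card_shapes_succ N
      simp only [hsymm, card_shapes_zero, Function.Embedding.prodMap, Function.Embedding.coeFn_mk,
        Prod.map, Function.Embedding.refl_apply, Nat.succ_eq_add_one]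
      linarith

/-! ### Canonical trees -/

/-- The tree with a given shape and given leaf labels. -/
def build : Shape → List (ℕ × Bool) → AOTree
  | .leaf, w => .leaf (w.headD (0, true)).1 (w.headD (0, true)).2
  | .node c a b, w => .node c (build a (w.take a.size)) (build b (w.drop a.size))

theorem shape_build (s : Shape) (w : List (ℕ × Bool)) : (build s w).shape = s := by
  induction s generalizing w with
  | leaf => rfl
  | node c a b ha hb => simp [build, AOTree.shape, ha, hb]

theorem leaves_build {s : Shape} {w : List (ℕ × Bool)} (h : w.length = s.size) :
    (build s w).leaves = w := by
  induction s generalizing w with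
  | leaf =>
    obtain ⟨x, rfl⟩ := List.length_eq_one_iff.1 h
    rfl
  | node c a b ha hb =>
    simp only [Shape.size] at h
    rw [build, AOTree.leaves, ha (by simp; omega), hb (by simp; omega), List.take_append_drop]

theorem build_shape_leaves (t : AOTree) : build t.shape t.leaves = t := by
  induction t with
  | leaf v b => rfl
  | node c l r hl hr =>
    simp only [AOTree.shape, AOTree.leaves, build, ← AOTree.length_leaves]
    rw [List.take_left, List.drop_left, hl, hr]

/-- The canonical trees with `N` internal nodes and at most `K` variables. -/
noncomputable def canonTrees (N K : ℕ) : Finset AOTree :=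
  (shapes N ×ˢ wordsLE (N + 1) K).image fun q => build q.1 q.2

theorem mem_canonTrees {N K : ℕ} {t : AOTree} :
    t ∈ canonTrees N K ↔ t.size = N + 1 ∧ t.varCount ≤ K ∧ Canon t.leaves := by
  simp only [canonTrees, Finset.mem_image, Finset.mem_product, Prod.exists, mem_shapes,
    mem_wordsLE (Nat.succ_pos N)]
  constructor
  · rintro ⟨s, w, ⟨hs, hw, hc, hK⟩, rfl⟩
    rw [AOTree.size, AOTree.varCount, leaves_build (hw.trans hs.symm)]
    exact ⟨hw, hK, hc⟩
  · rintro ⟨hs, hK, hc⟩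
    exact ⟨t.shape, t.leaves, ⟨t.length_leaves ▸ hs, hs, hc, hK⟩, build_shape_leaves t⟩

theorem sum_canonTrees {M : Type*} [AddCommMonoid M] (N K : ℕ) (f : AOTree → M) :
    ∑ t ∈ canonTrees N K, f t =
      ∑ s ∈ shapes N, ∑ w ∈ wordsLE (N + 1) K, f (build s w) := by
  rw [canonTrees, Finset.sum_image, Finset.sum_product]
  rintro ⟨s, w⟩ h ⟨s', w'⟩ h' e
  simp only [Finset.coe_product, Set.mem_prod, Finset.mem_coe, mem_shapes,
    mem_wordsLE (Nat.succ_pos N)] at h h' e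
  refine Prod.ext ?_ ?_
  · simpa [shape_build] using congrArg AOTree.shape e
  · simpa [leaves_build (h.2.1.trans h.1.symm), leaves_build (h'.2.1.trans h'.1.symm)] using
      congrArg AOTree.leaves e

theorem card_canonTrees (N K : ℕ) :
    (canonTrees N K).card = (shapes N).card * (wordsLE (N + 1) K).card := by
  rw [Finset.card_eq_sum_ones, sum_canonTrees]
  simp

theorem eq_of_treeEquiv_of_canon {t t' : AOTree} (ht : Canon t.leaves) (ht' : Canon t'.leaves)
    (h : TreeEquiv t t') : t = t' := by
  rw [← build_shape_leaves t, ← build_shape_leaves t', h.1,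
    h.wordEquiv.eq_of_canon h.length_eq ht ht']

theorem AOTree.size_map (f : ℕ × Bool → ℕ × Bool) (t : AOTree) : (t.map f).size = t.size := by
  rw [AOTree.size, AOTree.leaves_map, List.length_map, AOTree.size]

theorem AOTree.varCount_map_relabel (σ : Equiv.Perm ℕ) (ε : ℕ → Bool) (t : AOTree) :
    (t.map (relabel σ ε)).varCount = t.varCount := by
  rw [AOTree.varCount, AOTree.leaves_map]
  exact varNum_map_relabel σ ε t.leaves

theorem exists_map_mem_canonTrees {N K : ℕ} {t : AOTree} (hs : t.size = N + 1)
    (hK : t.varCount ≤ K) : ∃ σ ε, t.map (relabel σ ε) ∈ canonTrees N K := by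
  obtain ⟨σ, ε, h⟩ := exists_canon_relabel t.leaves
  refine ⟨σ, ε, mem_canonTrees.2 ⟨?_, ?_, ?_⟩⟩
  · rwa [AOTree.size_map]
  · rwa [AOTree.varCount_map_relabel]
  · rwa [AOTree.leaves_map]

theorem Tcount_succ (N K : ℕ) :
    Tcount (N + 1) K = (shapes N).card * (wordsLE (N + 1) K).card := by
  rw [Tcount, classCount_eq_card (canonTrees N K), card_canonTrees]
  · intro t ht
    rw [mem_canonTrees] at ht
    exact ⟨ht.1, ht.2.1⟩
  · rintro t ⟨hs, hK⟩
    obtain ⟨σ, ε, h⟩ := exists_map_mem_canonTrees hs hK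
    exact ⟨_, h, treeEquiv_map_relabel σ ε t⟩
  · intro t ht t' ht'
    exact eq_of_treeEquiv_of_canon (mem_canonTrees.1 ht).2.2 (mem_canonTrees.1 ht').2.2

/-! ### Simple-x trees -/

/-- The literals of the leaves linked to the root by nodes labelled `c` only. -/
def AOTree.litMarks (c : Conn) (t : AOTree) : Finset (ℕ × Bool) :=
  (t.shape.marks c).image (lv t)

theorem AOTree.litMarks_leaf (c : Conn) (v : ℕ) (b : Bool) :
    (AOTree.leaf v b).litMarks c = {(v, b)} := by
  simp [AOTree.litMarks, AOTree.shape, Shape.marks, lv, AOTree.leaves]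

theorem AOTree.litMarks_node (c c' : Conn) (l r : AOTree) : (AOTree.node c' l r).litMarks c =
    if c' = c then l.litMarks c ∪ r.litMarks c else ∅ := by
  simp only [AOTree.litMarks, AOTree.shape, Shape.marks]
  split_ifs with h
  · rw [Finset.image_union, Finset.image_image]
    congr 1
    · refine Finset.image_congr fun i hi => ?_
      have := Shape.lt_size_of_mem_marks hi
      rw [← AOTree.length_leaves] at this
      rw [lv, lv, AOTree.leaves, List.getD_append _ _ _ _ this]
    · refine Finset.image_congr fun i _ => ?_
      rw [Function.comp_apply, lv, lv, AOTree.leaves, ← AOTree.length_leaves,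
        List.getD_append_right _ _ _ _ (by omega), Nat.add_sub_cancel_left]
  · rfl

theorem AOTree.litMarks_map (c : Conn) (f : ℕ × Bool → ℕ × Bool) (t : AOTree) :
    (t.map f).litMarks c = (t.litMarks c).image f := by
  induction t with
  | leaf v b => simp [AOTree.map, AOTree.litMarks_leaf]
  | node c' l r hl hr =>
    simp only [AOTree.map, AOTree.litMarks_node, hl, hr]
    split_ifs <;> simp [Finset.image_union]

theorem AOTree.mem_leaves_of_mem_litMarks {c : Conn} {t : AOTree} {x : ℕ × Bool}
    (h : x ∈ t.litMarks c) : x ∈ t.leaves := by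
  induction t with
  | leaf v b => simpa [AOTree.leaves, AOTree.litMarks_leaf] using h
  | node c' l r hl hr =>
    rw [AOTree.litMarks_node] at h
    split_ifs at h
    · rw [AOTree.leaves, List.mem_append]
      exact (Finset.mem_union.1 h).imp hl hr
    · simp at h

theorem orLeaf_iff (t : AOTree) (x : ℕ × Bool) : orLeaf t x ↔ x ∈ t.litMarks .or := by
  induction t with
  | leaf v b => rw [orLeaf, AOTree.litMarks_leaf, Finset.mem_singleton, eq_comm]
  | node c l r hl hr => cases c <;> simp [orLeaf, AOTree.litMarks_node, hl, hr]

theorem andLeaf_iff (t : AOTree) (x : ℕ × Bool) : andLeaf t x ↔ x ∈ t.litMarks .and := by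
  induction t with
  | leaf v b => rw [andLeaf, AOTree.litMarks_leaf, Finset.mem_singleton, eq_comm]
  | node c l r hl hr => cases c <;> simp [andLeaf, AOTree.litMarks_node, hl, hr]

/-- The tree whose root has label opposite to `c` and has as children `s` and a single leaf
(on the left iff `left`). -/
def addLeaf (c : Conn) (left : Bool) (s : AOTree) (x : ℕ × Bool) : AOTree :=
  if left then .node c.flip (.leaf x.1 x.2) s else .node c.flip s (.leaf x.1 x.2)

theorem isSimpleXX_iff (t : AOTree) : IsSimpleXX t ↔
    ∃ c left s x, t = addLeaf c left s x ∧ x ∈ s.litMarks c := by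
  simp only [IsSimpleXX, orLeaf_iff, andLeaf_iff]
  constructor
  · rintro (⟨v, b, s, h | h, hx⟩ | ⟨v, b, s, h | h, hx⟩)
    exacts [⟨.or, true, s, (v, b), h, hx⟩, ⟨.or, false, s, (v, b), h, hx⟩,
      ⟨.and, true, s, (v, b), h, hx⟩, ⟨.and, false, s, (v, b), h, hx⟩]
  · rintro ⟨c, left, s, ⟨v, b⟩, rfl, hx⟩
    cases c
    · exact Or.inr ⟨v, b, s, by cases left <;> simp [addLeaf, Conn.flip], hx⟩
    · exact Or.inl ⟨v, b, s, by cases left <;> simp [addLeaf, Conn.flip], hx⟩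

theorem size_addLeaf (c : Conn) (left : Bool) (s : AOTree) (x : ℕ × Bool) :
    (addLeaf c left s x).size = s.size + 1 := by
  cases left <;> simp [addLeaf, AOTree.size, AOTree.leaves]

theorem varCount_addLeaf {c : Conn} (left : Bool) {s : AOTree} {x : ℕ × Bool}
    (hx : x ∈ s.litMarks c) : (addLeaf c left s x).varCount = s.varCount := by
  refine varNum_congr ?_
  have : x ∈ s.leaves.toFinset := by simpa using AOTree.mem_leaves_of_mem_litMarks hx
  cases left <;> ext y <;> simp [addLeaf, AOTree.leaves] <;> aesop

theorem map_addLeaf (f : ℕ × Bool → ℕ × Bool) (c : Conn) (left : Bool) (s : AOTree)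
    (x : ℕ × Bool) : (addLeaf c left s x).map f = addLeaf c left (s.map f) (f x) := by
  cases left <;> simp [addLeaf, AOTree.map]

theorem addLeaf_inj_of_treeEquiv {c c' : Conn} {left left' : Bool} {s s' : AOTree}
    {x x' : ℕ × Bool} (hs : 2 ≤ s.size) (hc : Canon s.leaves)
    (hc' : Canon s'.leaves) (hx : x ∈ s.litMarks c)
    (h : TreeEquiv (addLeaf c left s x) (addLeaf c' left' s' x')) :
    c = c' ∧ left = left' ∧ s = s' ∧ x = x' := by
  have key : c = c' ∧ left = left' ∧ s.shape = s'.shape := by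
    have h₁ := h.1
    rw [AOTree.size, AOTree.length_leaves] at hs
    cases left <;> cases left' <;>
      simp only [addLeaf, AOTree.shape, Shape.node.injEq, if_true, Bool.false_eq_true,
        if_false] at h₁
    · exact ⟨Conn.flip_injective h₁.1, rfl, h₁.2.1⟩
    · rw [h₁.2.1] at hs
      simp [Shape.size] at hs
    · rw [h₁.2.2] at hs
      simp [Shape.size] at hs
    · exact ⟨Conn.flip_injective h₁.1, rfl, h₁.2.2⟩
  obtain ⟨rfl, rfl, hshape⟩ := key
  have hlen : s.leaves.length = s'.leaves.length := by
    rw [AOTree.length_leaves, AOTree.length_leaves, hshape]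
  have hw : WordEquiv (x :: s.leaves) (x' :: s'.leaves) := by
    refine h.wordEquiv.mono ?_
    cases left
    · simp [addLeaf, AOTree.leaves, List.zip_append hlen]
    · simp [addLeaf, AOTree.leaves]
  have hleaves := (hw.mono (by simp)).eq_of_canon hlen hc hc'
  refine ⟨rfl, rfl, ?_, ?_⟩
  · rw [← build_shape_leaves s, ← build_shape_leaves s', hshape, hleaves]
  · have hmem := mem_zip_self (AOTree.mem_leaves_of_mem_litMarks hx)
    rw [hleaves] at hw hmem
    exact ((hw (x, x') (by simp) (x, x) (by simp [hmem])).2.1 rfl).symm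

theorem classCount_isSimpleXX {N : ℕ} (hN : 1 ≤ N) (K : ℕ) :
    classCount (fun t => t.size = N + 2 ∧ t.varCount ≤ K ∧ IsSimpleXX t) =
      2 * ∑ c : Conn, ∑ s ∈ canonTrees N K, (s.litMarks c).card := by
  let I : Finset (Σ _ : Bool × Conn × AOTree, ℕ × Bool) :=
    (Finset.univ ×ˢ Finset.univ ×ˢ canonTrees N K).sigma fun q => q.2.2.litMarks q.2.1
  let g : (Σ _ : Bool × Conn × AOTree, ℕ × Bool) → AOTree :=
    fun q => addLeaf q.1.2.1 q.1.1 q.1.2.2 q.2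
  have hI : ∀ q, q ∈ I ↔ q.1.2.2 ∈ canonTrees N K ∧ q.2 ∈ q.1.2.2.litMarks q.1.2.1 := by
    intro q
    simp [I]
  have hg : ∀ q ∈ I, ∀ q' ∈ I, TreeEquiv (g q) (g q') → q = q' := by
    rintro ⟨⟨left, c, s⟩, x⟩ hq ⟨⟨left', c', s'⟩, x'⟩ hq' h
    rw [hI, mem_canonTrees] at hq hq'
    dsimp only at hq hq'
    obtain ⟨rfl, rfl, rfl, rfl⟩ := addLeaf_inj_of_treeEquiv (by omega) hq.1.2.2
      hq'.1.2.2 hq.2 h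
    rfl
  rw [classCount_eq_card (I.image g), Finset.card_image_of_injOn, Finset.card_sigma,
    Finset.sum_product]
  · simp [Finset.sum_product]
  · intro q hq q' hq' h
    exact hg q hq q' hq' (h ▸ TreeEquiv.refl _)
  · intro t ht
    obtain ⟨q, hq, rfl⟩ := Finset.mem_image.1 ht
    rw [hI, mem_canonTrees] at hq
    refine ⟨?_, ?_, (isSimpleXX_iff _).2 ⟨_, _, _, _, rfl, hq.2⟩⟩
    · rw [size_addLeaf, hq.1.1]
    · rw [varCount_addLeaf _ hq.2]
      exact hq.1.2.1
  · rintro t ⟨hsize, hK, ht⟩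
    obtain ⟨c, left, s, x, rfl, hx⟩ := (isSimpleXX_iff _).1 ht
    rw [size_addLeaf] at hsize
    rw [varCount_addLeaf _ hx] at hK
    obtain ⟨σ, ε, h⟩ := exists_map_mem_canonTrees (N := N) (by omega) hK
    refine ⟨_, Finset.mem_image_of_mem g (a := ⟨⟨left, c, s.map (relabel σ ε)⟩, relabel σ ε x⟩)
      ((hI _).2 ⟨h, ?_⟩), ?_⟩
    · rw [AOTree.litMarks_map]
      exact Finset.mem_image_of_mem _ hx
    · simp only [g, ← map_addLeaf]
      exact treeEquiv_map_relabel σ ε _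
  · intro r hr r' hr' h
    obtain ⟨q, hq, rfl⟩ := Finset.mem_image.1 hr
    obtain ⟨q', hq', rfl⟩ := Finset.mem_image.1 hr'
    rw [hg q hq q' hq' h]

theorem sum_card_litMarks_le (c : Conn) (N K : ℕ) :
    ∑ s ∈ canonTrees N K, (s.litMarks c).card ≤ (shapes N).card * (wordsLE (N + 1) K).card := by
  rw [sum_canonTrees, ← sum_card_marks c N, Finset.sum_mul]
  refine Finset.sum_le_sum fun s _ => ?_
  rw [mul_comm, ← smul_eq_mul]
  refine Finset.sum_le_card_nsmul _ _ _ fun w _ => ?_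
  rw [AOTree.litMarks, shape_build]
  exact Finset.card_image_le

theorem card_le_card_image_add_card_collisions {α β : Type*} [LinearOrder α] [DecidableEq β]
    (s : Finset α) (f : α → β) :
    s.card ≤ (s.image f).card + ((s ×ˢ s).filter fun p => p.1 < p.2 ∧ f p.1 = f p.2).card := by
  rw [← Finset.card_filter_add_card_filter_not (s := s)
    (fun j => ∃ i ∈ s, i < j ∧ f i = f j), add_comm]
  gcongr
  · refine Finset.card_le_card_of_injOn f (fun j hj => ?_) (fun i hi j hj h => ?_)
    · exact Finset.mem_image_of_mem f (Finset.mem_filter.1 hj).1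
    · rw [Finset.mem_coe, Finset.mem_filter] at hi hj
      rcases lt_trichotomy i j with hij | hij | hij
      · exact (hj.2 ⟨i, hi.1, hij, h⟩).elim
      · exact hij
      · exact (hi.2 ⟨j, hj.1, hij, h.symm⟩).elim
  · refine le_trans (Finset.card_le_card fun j hj => ?_) (Finset.card_image_le (f := Prod.snd))
    obtain ⟨hj, i, hi, h⟩ := Finset.mem_filter.1 hj
    exact Finset.mem_image.2 ⟨(i, j), by simp [hi, hj, h], rfl⟩

theorem le_sum_card_litMarks_add (c : Conn) {N : ℕ} (hN : 1 ≤ N) (K : ℕ) :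
    (shapes N).card * (wordsLE (N + 1) K).card ≤
      ∑ s ∈ canonTrees N K, (s.litMarks c).card +
        (∑ s ∈ shapes N, (s.marks c).card ^ 2) * (wordsLE N K).card := by
  rw [sum_canonTrees, ← sum_card_marks c N, Finset.sum_mul, Finset.sum_mul,
    ← Finset.sum_add_distrib]
  refine Finset.sum_le_sum fun s hs => ?_
  rw [mem_shapes] at hs
  have h₁ : (s.marks c).card * (wordsLE (N + 1) K).card ≤ ∑ w ∈ wordsLE (N + 1) K,
      (((build s w).litMarks c).card + ((s.marks c ×ˢ s.marks c).filter fun p =>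
        p.1 < p.2 ∧ w.getD p.1 (0, true) = w.getD p.2 (0, true)).card) := by
    rw [mul_comm, ← smul_eq_mul]
    refine Finset.card_nsmul_le_sum _ _ _ fun w hw => ?_
    have hw := (mem_wordsLE (Nat.succ_pos N)).1 hw
    have := card_le_card_image_add_card_collisions (s.marks c) (lv (build s w))
    simp only [AOTree.litMarks, shape_build]
    simpa only [lv, leaves_build (hw.1.trans hs.symm)] using this
  refine h₁.trans ?_
  rw [Finset.sum_add_distrib]
  gcongr
  simp only [Finset.card_filter]
  rw [Finset.sum_comm, sq, ← Finset.card_product, ← smul_eq_mul]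
  refine Finset.sum_le_card_nsmul _ _ _ fun p hp => ?_
  rw [Finset.mem_product] at hp
  by_cases hlt : p.1 < p.2
  · simp only [hlt, true_and]
    rw [← Finset.card_filter]
    exact card_filter_wordsLE_le hN hlt (hs ▸ Shape.lt_size_of_mem_marks hp.2)
  · simp [hlt]

/-! ### The ratio `B m k / B (m + 1) k` -/

theorem stirling_le (m p : ℕ) : (stirling m p : ℝ) ≤ 2 ^ p * ((p : ℝ) + 1 / 2) ^ m := by
  induction m generalizing p with
  | zero => cases p <;> simp [stirling]
  | succ m ih =>
    cases p with
    | zero =>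
      simp only [stirling, Nat.cast_zero]
      positivity
    | succ p =>
      have h₁ := ih p
      have h₂ := ih (p + 1)
      have h₃ : ((p : ℝ) + 1 / 2) ^ m ≤ ((p : ℝ) + 1 + 1 / 2) ^ m := by gcongr; linarith
      simp only [stirling]
      push_cast at h₂ ⊢
      calc ((p : ℝ) + 1) * stirling m (p + 1) + stirling m p
          ≤ (p + 1) * (2 ^ (p + 1) * ((p : ℝ) + 1 + 1 / 2) ^ m) +
            2 ^ p * ((p : ℝ) + 1 + 1 / 2) ^ m := by gcongr; exact h₁.trans (by gcongr)
        _ = 2 ^ (p + 1) * ((p : ℝ) + 1 + 1 / 2) ^ (m + 1) := by ring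

theorem stirling_self_pos (p : ℕ) : 1 ≤ stirling p p := by
  induction p with
  | zero => exact le_rfl
  | succ p ih => exact ih.trans (Nat.le_add_left _ _)

theorem mul_stirling_le (m p : ℕ) : p * stirling m p ≤ stirling (m + 1) p := by
  cases p with
  | zero => simp
  | succ p => exact Nat.le_add_right _ _

theorem pow_le_stirling_mul {m p : ℕ} (h : p ≤ m) : p ^ m ≤ stirling m p * p ^ p := by
  induction m, h using Nat.le_induction with
  | base => exact Nat.le_mul_of_pos_left _ (stirling_self_pos p)
  | succ m _ ih =>
    calc p ^ (m + 1) = p * p ^ m := pow_succ' _ _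
      _ ≤ p * (stirling m p * p ^ p) := by gcongr
      _ = p * stirling m p * p ^ p := by ring
      _ ≤ stirling (m + 1) p * p ^ p := by gcongr; exact mul_stirling_le m p

theorem stirling_div_le_B {m p K : ℕ} (hp : 1 ≤ p) (hK : p ≤ K) :
    (stirling m p : ℝ) / 2 ^ p ≤ B m K :=
  Finset.single_le_sum (f := fun p => (stirling m p : ℝ) / 2 ^ p) (fun _ _ => by positivity)
    (Finset.mem_Icc.2 ⟨hp, hK⟩)

theorem mul_B_le (m M K : ℕ) :
    (M : ℝ) * B m K ≤ B (m + 1) K + M ^ 2 * ((M : ℝ) - 1 / 2) ^ m := by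
  have hterm : ∀ p ∈ Finset.Icc 1 K, (M : ℝ) * (stirling m p / 2 ^ p) ≤
      stirling (m + 1) p / 2 ^ p + if p < M then M * ((M : ℝ) - 1 / 2) ^ m else 0 := by
    intro p _
    split_ifs with h
    · have hpM : (p : ℝ) + 1 ≤ M := by exact_mod_cast h
      have h₁ : (stirling m p : ℝ) / 2 ^ p ≤ ((M : ℝ) - 1 / 2) ^ m := by
        rw [div_le_iff₀' (by positivity)]
        refine (stirling_le m p).trans ?_
        gcongr
        linarith
      have h₂ : (0 : ℝ) ≤ stirling (m + 1) p / 2 ^ p := by positivity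
      nlinarith [mul_le_mul_of_nonneg_left h₁ (Nat.cast_nonneg (α := ℝ) M)]
    · rw [add_zero, ← mul_div_assoc]
      gcongr
      have h₁ : M * stirling m p ≤ stirling (m + 1) p :=
        (Nat.mul_le_mul_right _ (not_lt.1 h)).trans (mul_stirling_le m p)
      exact_mod_cast h₁
  rw [B, B, Finset.mul_sum]
  refine (Finset.sum_le_sum hterm).trans ?_
  rw [Finset.sum_add_distrib, ← Finset.sum_filter, Finset.sum_const, nsmul_eq_mul]
  refine add_le_add le_rfl ?_
  rcases Nat.eq_zero_or_pos M with rfl | hM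
  · simp
  · have hcard : ((Finset.Icc 1 K).filter (· < M)).card ≤ M := by
      conv_rhs => rw [← Finset.card_range M]
      refine Finset.card_le_card fun p hp => ?_
      rw [Finset.mem_range]
      exact (Finset.mem_filter.1 hp).2
    have hM' : (1 : ℝ) ≤ M := by exact_mod_cast hM
    have : (0 : ℝ) ≤ (M : ℝ) - 1 / 2 := by linarith
    rw [sq, mul_assoc]
    gcongr

theorem eventually_sq_mul_pow_le_B {M : ℕ} (hM : 1 ≤ M) :
    ∀ᶠ m in atTop, ∀ K, M ≤ K → (M : ℝ) ^ 2 * ((M : ℝ) - 1 / 2) ^ m ≤ B m K := by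
  have hM' : (1 : ℝ) ≤ M := by exact_mod_cast hM
  have hM₀ : (0 : ℝ) < M := by linarith
  have hlim : Tendsto (fun m : ℕ => (M : ℝ) ^ 2 * (2 ^ M * M ^ M) * (((M : ℝ) - 1 / 2) / M) ^ m)
      atTop (nhds 0) := by
    have := tendsto_pow_atTop_nhds_zero_of_lt_one (r := ((M : ℝ) - 1 / 2) / M)
      (div_nonneg (by linarith) hM₀.le) ((div_lt_one hM₀).2 (by linarith))
    simpa using this.const_mul ((M : ℝ) ^ 2 * (2 ^ M * M ^ M))
  filter_upwards [hlim.eventually_le_const one_pos, eventually_ge_atTop M] with m hm hMm K hK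
  refine le_trans ?_ (stirling_div_le_B hM hK)
  have h₁ : (M : ℝ) ^ m ≤ stirling m M * M ^ M := by exact_mod_cast pow_le_stirling_mul hMm
  rw [div_pow, ← mul_div_assoc, div_le_one (by positivity)] at hm
  rw [le_div_iff₀ (by positivity)]
  have h₂ := hm.trans h₁
  refine le_of_mul_le_mul_right ?_ (show (0 : ℝ) < M ^ M by positivity)
  linarith

theorem tendsto_B_div {K : ℕ → ℕ} (hK : Tendsto K atTop atTop) :
    Tendsto (fun m => B m (K m) / B (m + 1) (K m)) atTop (nhds 0) := by
  refine Metric.tendsto_nhds.2 fun ε hε => ?_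
  obtain ⟨M, hM⟩ := exists_nat_gt (1 / ε + 1)
  have hM₁ : (1 : ℝ) < M := by linarith [one_div_pos.2 hε]
  have hM₂ : 1 ≤ M := by exact_mod_cast hM₁.le
  filter_upwards [eventually_sq_mul_pow_le_B hM₂, hK.eventually_ge_atTop M,
    eventually_ge_atTop 1] with m h hKm hm
  have h₁ := h _ hKm
  have h₂ := mul_B_le m M (K m)
  have hB := B_pos hm (hM₂.trans hKm)
  have hB' := B_pos (Nat.le_succ_of_le hm) (hM₂.trans hKm)
  rw [Real.dist_eq, sub_zero, abs_of_pos (div_pos hB hB'), div_lt_iff₀ hB']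
  have h₃ : 1 / ε * B m (K m) < B (m + 1) (K m) := by nlinarith
  rw [one_div, inv_mul_lt_iff₀ hε] at h₃
  exact h₃

theorem ratio_bounds {N K : ℕ} (hN : 1 ≤ N) (hK : 1 ≤ K) :
    let X : ℝ := (classCount fun t => t.size = N + 2 ∧ t.varCount ≤ K ∧ IsSimpleXX t : ℕ)
    let v : ℝ := X / Tcount (N + 2) K / (B (N + 1) K / B (N + 2) K)
    2 * ((shapes N).card / (shapes (N + 1)).card : ℝ) - 1 / 2 * (B N K / B (N + 1) K) ≤ v ∧
      v ≤ 2 * ((shapes N).card / (shapes (N + 1)).card : ℝ) := by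
  intro X v
  have hS : (0 : ℝ) < (shapes (N + 1)).card := by exact_mod_cast card_shapes_pos (N + 1)
  have hB₁ : 0 < B (N + 1) K := B_pos (by omega) hK
  have hB₂ : 0 < B (N + 2) K := B_pos (by omega) hK
  have hT : (Tcount (N + 2) K : ℝ) = (shapes (N + 1)).card * (2 ^ (N + 2) * B (N + 2) K) := by
    rw [Tcount_succ, Nat.cast_mul, card_wordsLE]
  have hX : X = 2 * ∑ c : Conn, ((∑ s ∈ canonTrees N K, (s.litMarks c).card : ℕ) : ℝ) := by
    simp only [X, classCount_isSimpleXX hN]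
    push_cast
    rfl
  have hv : v = X / ((shapes (N + 1)).card * (2 ^ (N + 2) * B (N + 1) K)) := by
    simp only [v, hT]
    field_simp
  have hu : ∀ c : Conn, ((∑ s ∈ canonTrees N K, (s.litMarks c).card : ℕ) : ℝ) ≤
      (shapes N).card * (2 ^ (N + 1) * B (N + 1) K) := by
    intro c
    rw [← card_wordsLE]
    exact_mod_cast sum_card_litMarks_le c N K
  have hl : ∀ c : Conn, (shapes N).card * (2 ^ (N + 1) * B (N + 1) K) -
      1 / 2 * (shapes (N + 1)).card * (2 ^ N * B N K) ≤
      ((∑ s ∈ canonTrees N K, (s.litMarks c).card : ℕ) : ℝ) := by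
    intro c
    rw [← card_wordsLE, ← card_wordsLE, ← sum_card_marks_sq c N, sub_le_iff_le_add, Nat.cast_mul,
      Nat.cast_two, ← mul_assoc, one_div_mul_cancel two_ne_zero, one_mul]
    exact_mod_cast le_sum_card_litMarks_add c hN K
  have hl' := Finset.card_nsmul_le_sum Finset.univ _ _ fun c _ => hl c
  have hu' := Finset.sum_le_card_nsmul Finset.univ _ _ fun c _ => hu c
  rw [Finset.card_univ, Conn.card, nsmul_eq_mul, Nat.cast_two] at hl' hu'
  rw [hv, hX, le_div_iff₀ (by positivity), div_le_iff₀ (by positivity)]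
  constructor
  · refine le_trans (le_of_eq ?_) (mul_le_mul_of_nonneg_left hl' two_pos.le)
    field_simp
    ring
  · refine le_trans (mul_le_mul_of_nonneg_left hu' two_pos.le) (le_of_eq ?_)
    field_simp
    ring

/-- the ratio of simple-x trees of type X satisfies
`X^X_n/T_n ∼ (1/4)·rat_n`. -/
theorem stmt_15 (k : ℕ → ℕ) (hk_mono : Monotone k)
    (hk_pos : ∀ n, 1 ≤ n → 1 ≤ k n) (hk_le : ∀ n, 1 ≤ n → k n ≤ n)
    (hk_tend : Tendsto k atTop atTop) :
    Tendsto
      (fun n =>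
        ((classCount fun t =>
            t.size = n ∧ t.varCount ≤ k n ∧ IsSimpleXX t : ℕ) : ℝ)
          / (Tcount n (k n) : ℝ) / rat k n)
      atTop (nhds (1 / 4)) := by
  rw [← tendsto_add_atTop_iff_nat 2]
  have hb := tendsto_B_div (hk_tend.comp (tendsto_add_atTop_nat 2))
  have hu := tendsto_card_shapes_div.const_mul 2
  have hl := hu.sub (hb.const_mul (1 / 2))
  rw [show (2 : ℝ) * (1 / 8) = 1 / 4 by norm_num] at hu
  rw [show (2 : ℝ) * (1 / 8) - 1 / 2 * 0 = 1 / 4 by norm_num] at hl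
  refine tendsto_of_tendsto_of_tendsto_of_le_of_le' hl hu ?_ ?_
  · filter_upwards [eventually_ge_atTop 1] with N hN
    exact (ratio_bounds hN (hk_pos (N + 2) (by omega))).1
  · filter_upwards [eventually_ge_atTop 1] with N hN
    exact (ratio_bounds hN (hk_pos (N + 2) (by omega))).2

end CatalanSat
end
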